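/- Consider a discrete memoryless state-dependent relay channel p(y2,y3|x1,x2,s) with i.i.d. state S_j ~ p(s) known non-causally and perfectly only at the relay, where a single message W13 is sent from the source to the destination with the help of the relay. Let Q2, X2, Ŷ2 be random variables on finite alphabets with joint pmf p(s)·p(q2|s)·p(x2|q2,s)·p(x1)·p(y2,y3|x1,x2,s)·p(ŷ2|y2,q2,s). If R13 < I(X1;Ŷ2,Y3|Q2), subject to the constraint I(Ŷ2;Y2,S|Q2,Y3) ≤ I(Q2;Y3) − I(Q2;S), then the rate R13 is achievable (this is the specialization of the SD-RCPM non-causal region obtained by setting S1, T2, K2 trivial, S2=S, and T1=X1). -/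

import Mathlib

/- Statement 8: Achievable rate (compress-and-forward with Gel'fand–Pinsker coding at
the relay) for the discrete memoryless state-dependent relay channel with non-causal
perfect CSI only at the relay. -/

open Finset
open scoped Classical

noncomputable section

/-- `p` is a probability mass function on a finite type. -/
def IsPmf {A : Type} [Fintype A] (p : A → ℝ) : Prop :=
  (∀ a, 0 ≤ p a) ∧ ∑ a, p a = 1

/-- `p` is a transition kernel: for each `a`, `p a` is a pmf. -/
def IsKernel {A B : Type} [Fintype B] (p : A → B → ℝ) : Prop :=
  ∀ a, IsPmf (p a)

/-- Distribution (pmf) of a random variable `X` under the pmf `μ` on `Ω`. -/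
def rvDist {Ω A : Type} [Fintype Ω] (μ : Ω → ℝ) (X : Ω → A) (a : A) : ℝ :=
  ∑ ω, if X ω = a then μ ω else 0

/-- Shannon entropy (in bits) of the random variable `X` under `μ`. -/
def rvEnt {Ω A : Type} [Fintype Ω] [Fintype A] (μ : Ω → ℝ) (X : Ω → A) : ℝ :=
  -∑ a, rvDist μ X a * Real.logb 2 (rvDist μ X a)

/-- Mutual information `I(X;Y)` under `μ`. -/
def rvMI {Ω A B : Type} [Fintype Ω] [Fintype A] [Fintype B]
    (μ : Ω → ℝ) (X : Ω → A) (Y : Ω → B) : ℝ :=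
  rvEnt μ X + rvEnt μ Y - rvEnt μ (fun ω => (X ω, Y ω))

/-- Conditional mutual information `I(X;Y|Z)` under `μ`. -/
def rvCMI {Ω A B C : Type} [Fintype Ω] [Fintype A] [Fintype B] [Fintype C]
    (μ : Ω → ℝ) (X : Ω → A) (Y : Ω → B) (Z : Ω → C) : ℝ :=
  rvEnt μ (fun ω => (X ω, Z ω)) + rvEnt μ (fun ω => (Y ω, Z ω))
    - rvEnt μ (fun ω => (X ω, Y ω, Z ω)) - rvEnt μ Z

section SDRC

variable {𝒳₁ 𝒳₂ 𝒴₂ 𝒴₃ 𝒮 : Type}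
  [Fintype 𝒳₁] [Fintype 𝒳₂] [Fintype 𝒴₂] [Fintype 𝒴₃] [Fintype 𝒮]

/-- Average probability of error of a `(M13, n)` code for the SD-RC with non-causal
perfect CSI only at the relay: the message is uniform, states i.i.d. `∼ pS`, channel
memoryless `W`; the source encoder has no state information. -/
def errProbRCrel (pS : 𝒮 → ℝ) (W : 𝒳₁ → 𝒳₂ → 𝒮 → 𝒴₂ × 𝒴₃ → ℝ)
    {n M13 : ℕ}
    (enc1 : Fin M13 → Fin n → 𝒳₁)
    (enc2 : (Fin n → 𝒮) → (Fin n → 𝒴₂) → Fin n → 𝒳₂)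
    (dec2 : (Fin n → 𝒴₃) → Fin M13) : ℝ :=
  ∑ w13 : Fin M13, ∑ sv : Fin n → 𝒮, ∑ yv : Fin n → 𝒴₂ × 𝒴₃,
    if dec2 (fun j => (yv j).2) = w13 then 0
    else (M13 : ℝ)⁻¹ * (∏ j, pS (sv j)) *
      ∏ j, W (enc1 w13 j) (enc2 sv (fun i => (yv i).1) j) (sv j) (yv j)

/-- Achievability of a rate `R13` for the SD-RC with non-causal perfect CSI only at
the relay. -/
def AchievableRCrel (pS : 𝒮 → ℝ) (W : 𝒳₁ → 𝒳₂ → 𝒮 → 𝒴₂ × 𝒴₃ → ℝ)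
    (R13 : ℝ) : Prop :=
  ∀ ε : ℝ, 0 < ε →
    ∃ (n M13 : ℕ)
      (enc1 : Fin M13 → Fin n → 𝒳₁)
      (enc2 : (Fin n → 𝒮) → (Fin n → 𝒴₂) → Fin n → 𝒳₂)
      (dec2 : (Fin n → 𝒴₃) → Fin M13),
      0 < n ∧
      (2 : ℝ) ^ ((n : ℝ) * R13) ≤ M13 ∧
      (∀ s y y' (j : Fin n), (∀ i, i < j → y i = y' i) → enc2 s y j = enc2 s y' j) ∧
      errProbRCrel pS W enc1 enc2 dec2 ≤ ε

end SDRC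

section Joint

variable {𝒮 Q₂ 𝒳₁ 𝒳₂ 𝒴₂ 𝒴₃ YH : Type}

/-- Sample space carrying `(S, Q₂, X₁, X₂, Y₂, Y₃, Ŷ₂)`. -/
abbrev ΩRCrel (𝒮 Q₂ 𝒳₁ 𝒳₂ 𝒴₂ 𝒴₃ YH : Type) : Type :=
  𝒮 × Q₂ × 𝒳₁ × 𝒳₂ × 𝒴₂ × 𝒴₃ × YH

def vS (ω : ΩRCrel 𝒮 Q₂ 𝒳₁ 𝒳₂ 𝒴₂ 𝒴₃ YH) : 𝒮 := ω.1
def vQ2 (ω : ΩRCrel 𝒮 Q₂ 𝒳₁ 𝒳₂ 𝒴₂ 𝒴₃ YH) : Q₂ := ω.2.1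
def vX1 (ω : ΩRCrel 𝒮 Q₂ 𝒳₁ 𝒳₂ 𝒴₂ 𝒴₃ YH) : 𝒳₁ := ω.2.2.1
def vX2 (ω : ΩRCrel 𝒮 Q₂ 𝒳₁ 𝒳₂ 𝒴₂ 𝒴₃ YH) : 𝒳₂ := ω.2.2.2.1
def vY2 (ω : ΩRCrel 𝒮 Q₂ 𝒳₁ 𝒳₂ 𝒴₂ 𝒴₃ YH) : 𝒴₂ := ω.2.2.2.2.1
def vY3 (ω : ΩRCrel 𝒮 Q₂ 𝒳₁ 𝒳₂ 𝒴₂ 𝒴₃ YH) : 𝒴₃ := ω.2.2.2.2.2.1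
def vYH (ω : ΩRCrel 𝒮 Q₂ 𝒳₁ 𝒳₂ 𝒴₂ 𝒴₃ YH) : YH := ω.2.2.2.2.2.2

end Joint

open MeasureTheory ProbabilityTheory in
lemma expMeasure_one_Ioi {x : ℝ} (hx : 0 ≤ x) :
    expMeasure 1 (Set.Ioi x) = ENNReal.ofReal (Real.exp (-x)) := by
  have := isProbabilityMeasure_expMeasure one_pos
  have h := cdf_expMeasure_eq one_pos x
  rw [if_pos hx, one_mul, cdf_eq_real] at h
  rw [← Set.compl_Iic, prob_compl_eq_one_sub measurableSet_Iic, ← ENNReal.ofReal_toReal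
    (measure_ne_top (expMeasure 1) (Set.Iic x)), ← ENNReal.ofReal_one,
    ← ENNReal.ofReal_sub _ ENNReal.toReal_nonneg]
  congr 1
  simp only [Measure.real] at h
  rw [h]; ring

open MeasureTheory ProbabilityTheory in
lemma lintegral_exp_neg_expMeasure_one {f : ℝ → ENNReal} {C : ℝ} (hC : 0 ≤ C)
    (hf : ∀ x, 0 ≤ x → f x = ENNReal.ofReal (Real.exp (-(C * x)))) (hfm : Measurable f) :
    ∫⁻ x, f x ∂(expMeasure 1) = ENNReal.ofReal (1 / (1 + C)) := by
  have h1 : (expMeasure 1) = volume.withDensity (exponentialPDF 1) := rfl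
  have hm : ∀ r, Measurable (exponentialPDF r) := fun r =>
    (measurable_exponentialPDFReal r).ennreal_ofReal
  rw [h1, lintegral_withDensity_eq_lintegral_mul _ (hm 1) hfm]
  have h2 : ∀ x, (exponentialPDF 1 * f) x
      = ENNReal.ofReal (1 / (1 + C)) * exponentialPDF (1 + C) x := by
    intro x
    rcases lt_or_ge x 0 with hx | hx
    · simp [exponentialPDF_of_neg hx]
    · rw [Pi.mul_apply, exponentialPDF_of_nonneg hx, exponentialPDF_of_nonneg hx, hf x hx,
        ← ENNReal.ofReal_mul (by positivity), ← ENNReal.ofReal_mul (by positivity)]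
      congr 1
      rw [one_mul, ← Real.exp_add]
      field_simp
      congr 1
      ring
  simp_rw [h2]
  rw [lintegral_const_mul _ (hm _), lintegral_exponentialPDF_eq_one (by linarith), mul_one]

/-- The event that the clock at `u` wins the race with relative speeds `c`. -/
def raceSet {U : Type} (u : U) (c : U → ℝ) : Set (U → ℝ) :=
  {z | 0 ≤ z u ∧ ∀ v, v ≠ u → c v * z u < z v}

/-- The law of independent unit exponential clocks. -/
def clocks (U : Type) [Fintype U] : MeasureTheory.Measure (U → ℝ) :=
  MeasureTheory.Measure.pi (fun _ => ProbabilityTheory.expMeasure 1)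

instance (U : Type) [Fintype U] : MeasureTheory.IsProbabilityMeasure (clocks U) := by
  have := ProbabilityTheory.isProbabilityMeasure_expMeasure one_pos
  unfold clocks; infer_instance

lemma measurableSet_raceSet {U : Type} [Fintype U] (u : U) (c : U → ℝ) :
    MeasurableSet (raceSet u c) := by
  have : raceSet u c = {z | 0 ≤ z u} ∩ ⋂ v, {z : U → ℝ | v ≠ u → c v * z u < z v} := by
    ext z; simp [raceSet]
  rw [this]
  refine (measurableSet_le (by fun_prop) (by fun_prop)).inter (MeasurableSet.iInter fun v => ?_)
  by_cases h : v = u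
  · simp [h]
  · simp only [ne_eq, h, not_false_eq_true, true_imp_iff]
    exact measurableSet_lt (by fun_prop) (by fun_prop)

open MeasureTheory ProbabilityTheory in
lemma clocks_raceSet {U : Type} [Fintype U] (u : U) (c : U → ℝ) (hc : ∀ v, 0 ≤ c v) :
    clocks U (raceSet u c) = ENNReal.ofReal (1 / (1 + ∑ v ∈ univ.filter (· ≠ u), c v)) := by
  have := isProbabilityMeasure_expMeasure one_pos
  have mp := measurePreserving_piEquivPiSubtypeProd (fun _ : U => expMeasure 1) (fun v => v = u)
  have mu := measurePreserving_funUnique (expMeasure 1) {v : U // v = u}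
  set A : Set (({v : U // v = u} → ℝ) × ({v : U // ¬ v = u} → ℝ)) :=
    {p | 0 ≤ p.1 ⟨u, rfl⟩ ∧ ∀ v : {v : U // ¬ v = u}, c v * p.1 ⟨u, rfl⟩ < p.2 v} with hA
  have hAm : MeasurableSet A := by
    have : A = {p | 0 ≤ p.1 ⟨u, rfl⟩} ∩
        ⋂ v : {v : U // ¬ v = u}, {p | c v * p.1 ⟨u, rfl⟩ < p.2 v} := by
      ext z; simp [hA]
    rw [this]
    exact (measurableSet_le (by fun_prop) (by fun_prop)).inter
      (MeasurableSet.iInter fun v => measurableSet_lt (by fun_prop) (by fun_prop))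
  have hpre : raceSet u c =
      (MeasurableEquiv.piEquivPiSubtypeProd (fun _ : U => ℝ) (fun v => v = u)) ⁻¹' A := by
    ext z
    simp [hA, raceSet, MeasurableEquiv.piEquivPiSubtypeProd, Equiv.piEquivPiSubtypeProd]
  unfold clocks
  rw [hpre, mp.measure_preimage hAm.nullMeasurableSet, Measure.prod_apply hAm]
  have e2 : ∀ x : {v : U // v = u} → ℝ,
      (Measure.pi fun _ : {v : U // ¬ v = u} => expMeasure 1) (Prod.mk x ⁻¹' A)
      = (fun t => if 0 ≤ t then ∏ v : {v : U // ¬ v = u}, expMeasure 1 (Set.Ioi (c v * t)) else 0)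
        (MeasurableEquiv.funUnique {v : U // v = u} ℝ x) := by
    intro x
    have hx : MeasurableEquiv.funUnique {v : U // v = u} ℝ x = x ⟨u, rfl⟩ := rfl
    rw [hx]
    by_cases h0 : 0 ≤ x ⟨u, rfl⟩
    · simp only [h0, if_true]
      rw [← Measure.pi_pi]
      congr 1
      ext y
      simp [hA, h0]
    · simp [hA, h0]
  have hmeas : Measurable (fun t : ℝ =>
      if 0 ≤ t then ∏ v : {v : U // ¬ v = u}, expMeasure 1 (Set.Ioi (c v * t)) else 0) := by
    refine Measurable.ite measurableSet_Ici (Finset.measurable_prod _ fun v _ => ?_)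
      measurable_const
    have : Antitone fun t : ℝ => expMeasure 1 (Set.Ioi (c v * t)) := fun a b hab =>
      measure_mono (Set.Ioi_subset_Ioi (mul_le_mul_of_nonneg_left hab (hc v)))
    exact this.measurable
  refine (lintegral_congr e2).trans ?_
  refine Eq.trans (b := ∫⁻ t, (if 0 ≤ t then
    ∏ v : {v : U // ¬ v = u}, expMeasure 1 (Set.Ioi (c v * t)) else 0) ∂(expMeasure 1)) ?_ ?_
  · rw [← mu.lintegral_comp hmeas]
    congr!
  have hsum : ∑ v ∈ univ.filter (· ≠ u), c v = ∑ v : {v : U // ¬ v = u}, c v := by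
    rw [Finset.sum_subtype]; simp
  rw [hsum]
  refine lintegral_exp_neg_expMeasure_one (Finset.sum_nonneg fun v _ => hc v) ?_ hmeas
  intro x hx
  rw [if_pos hx, Finset.prod_congr rfl fun (v : {v : U // ¬ v = u}) _ =>
      expMeasure_one_Ioi (mul_nonneg (hc v) hx),
    ← ENNReal.ofReal_prod_of_nonneg (fun _ _ => (Real.exp_pos _).le), ← Real.exp_sum,
    Finset.sum_neg_distrib, Finset.sum_mul]


lemma race_winner_unique {U : Type} {z : U → ℝ} {p : U → ℝ} {u v : U} (hu : 0 < p u)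
    (hv : 0 < p v) (h1 : z ∈ raceSet u (fun w => p w / p u))
    (h2 : z ∈ raceSet v (fun w => p w / p v)) : u = v := by
  by_contra hne
  have a1 := h1.2 v (Ne.symm hne)
  have a2 := h2.2 u hne
  rw [div_mul_eq_mul_div, div_lt_iff₀ hu] at a1
  rw [div_mul_eq_mul_div, div_lt_iff₀ hv] at a2
  linarith

/-- The winner of the race in which the clock at `u` runs at speed `p u`. -/
def raceWinner {U : Type} [Nonempty U] (z : U → ℝ) (p : U → ℝ) : U :=
  if h : ∃ u, 0 < p u ∧ z ∈ raceSet u (fun w => p w / p u) then h.choose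
  else Classical.arbitrary U

lemma raceWinner_eq {U : Type} [Nonempty U] {z : U → ℝ} {p : U → ℝ} {u : U} (hu : 0 < p u)
    (h : z ∈ raceSet u (fun w => p w / p u)) : raceWinner z p = u := by
  have hex : ∃ u, 0 < p u ∧ z ∈ raceSet u (fun w => p w / p u) := ⟨u, hu, h⟩
  rw [raceWinner, dif_pos hex]
  exact race_winner_unique hex.choose_spec.1 hu hex.choose_spec.2 h

lemma measurableSet_raceWinner {U : Type} [Fintype U] [Nonempty U] (p : U → ℝ) (u : U) :
    MeasurableSet {z | raceWinner z p = u} := by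
  have hS : ∀ v, MeasurableSet {z : U → ℝ | 0 < p v ∧ z ∈ raceSet v (fun w => p w / p v)} := by
    intro v
    by_cases hv : 0 < p v
    · simpa [hv] using measurableSet_raceSet v (fun w => p w / p v)
    · simp [hv]
  have : {z | raceWinner z p = u} = {z : U → ℝ | 0 < p u ∧ z ∈ raceSet u (fun w => p w / p u)} ∪
      ({z : U → ℝ | u = Classical.arbitrary U} ∩
        (⋃ v, {z : U → ℝ | 0 < p v ∧ z ∈ raceSet v (fun w => p w / p v)})ᶜ) := by
    ext z
    simp only [Set.mem_ofPred_eq, Set.mem_union, Set.mem_inter_iff, Set.mem_compl_iff,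
      Set.mem_iUnion]
    constructor
    · intro h
      by_cases hex : ∃ v, 0 < p v ∧ z ∈ raceSet v (fun w => p w / p v)
      · rw [raceWinner, dif_pos hex] at h
        exact Or.inl (h ▸ hex.choose_spec)
      · rw [raceWinner, dif_neg hex] at h
        exact Or.inr ⟨h.symm, hex⟩
    · rintro (h | ⟨h, hex⟩)
      · exact raceWinner_eq h.1 h.2
      · rw [raceWinner, dif_neg hex, h]
  rw [this]
  exact (hS u).union ((MeasurableSet.const _).inter (MeasurableSet.iUnion hS).compl)

/-- Bound on the probability that a sample of weight `p` is not reproduced by a sampler giving it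
the weight `q`. -/
def mismatch (lam p q : ℝ) : ℝ := if q = 0 then 1 else if q = 1 then 0 else (p / q) ^ lam

lemma clocks_real_raceSet {U : Type} [Fintype U] (u : U) (c : U → ℝ) (hc : ∀ v, 0 ≤ c v) :
    (clocks U).real (raceSet u c) = 1 / (1 + ∑ v ∈ univ.filter (· ≠ u), c v) := by
  have := Finset.sum_nonneg (s := univ.filter (· ≠ u)) fun v _ => hc v
  rw [MeasureTheory.Measure.real, clocks_raceSet u c hc, ENNReal.toReal_ofReal (by positivity)]

lemma clocks_raceWinner {U : Type} [Fintype U] [Nonempty U] (p : U → ℝ) (hp : ∀ u, 0 ≤ p u)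
    (hp1 : ∑ u, p u = 1) (u : U) : (clocks U).real {z | raceWinner z p = u} = p u := by
  have hle : ∀ u ∈ univ, p u ≤ (clocks U).real {z | raceWinner z p = u} := by
    intro u _
    rcases (hp u).eq_or_lt with h | h
    · rw [← h]; exact MeasureTheory.measureReal_nonneg
    · have h1 : (clocks U).real (raceSet u (fun w => p w / p u)) = p u := by
        rw [clocks_real_raceSet _ _ fun v => div_nonneg (hp v) h.le, ← Finset.sum_div]
        have := Finset.sum_erase_add univ p (mem_univ u)
        rw [← Finset.filter_ne', hp1] at this
        rw [show 1 + (∑ v ∈ univ.filter (· ≠ u), p v) / p u = 1 / p u by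
          field_simp; linarith, one_div_one_div]
      conv_lhs => rw [← h1]
      exact MeasureTheory.measureReal_mono fun z hz => raceWinner_eq h hz
  have hsum : ∑ u, (clocks U).real {z | raceWinner z p = u} = 1 := by
    have := MeasureTheory.sum_measureReal_preimage_singleton (μ := clocks U) (univ : Finset U)
      (f := fun z => raceWinner z p) fun y _ => measurableSet_raceWinner p y
    simpa [Set.preimage] using this
  exact ((Finset.sum_eq_sum_iff_of_le hle).1 (hp1.trans hsum.symm) u (mem_univ u)).symm

lemma clocks_raceWinner_mismatch {U : Type} [Fintype U] [Nonempty U] (p q : U → ℝ)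
    (hp : ∀ u, 0 ≤ p u) (hp1 : ∑ u, p u = 1) (hq : ∀ u, 0 ≤ q u) (hq1 : ∑ u, q u = 1)
    {lam : ℝ} (h0 : 0 ≤ lam) (h1 : lam ≤ 1) (u : U) :
    (clocks U).real {z | raceWinner z p = u ∧ raceWinner z q ≠ u} ≤
      p u * mismatch lam (p u) (q u) := by
  have hle : (clocks U).real {z | raceWinner z p = u ∧ raceWinner z q ≠ u} ≤ p u := by
    conv_rhs => rw [← clocks_raceWinner p hp hp1 u]
    exact MeasureTheory.measureReal_mono fun z hz => hz.1
  unfold mismatch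
  split_ifs with hq0 hq2
  · simpa using hle
  · have hs : (clocks U).real {z | raceWinner z q = u}ᶜ = 0 := by
      rw [MeasureTheory.probReal_compl_eq_one_sub (measurableSet_raceWinner q u),
        clocks_raceWinner q hq hq1, hq2, sub_self]
    rw [mul_zero, ← hs]
    exact MeasureTheory.measureReal_mono fun z hz => hz.2
  rcases (hp u).eq_or_lt with hpu | hpu
  · rw [← hpu] at hle ⊢; simpa using hle
  have hqu : 0 < q u := lt_of_le_of_ne (hq u) (Ne.symm hq0)
  set c : U → ℝ := fun v => max (p v / p u) (q v / q u) with hc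
  have hc0 : ∀ v, 0 ≤ c v := fun v => le_max_of_le_left (div_nonneg (hp v) hpu.le)
  have hsub : raceSet u c ⊆ {z | raceWinner z p = u ∧ raceWinner z q = u} := by
    intro z hz
    constructor
    · exact raceWinner_eq hpu ⟨hz.1, fun v hv => lt_of_le_of_lt
        (mul_le_mul_of_nonneg_right (le_max_left _ _) hz.1) (hz.2 v hv)⟩
    · exact raceWinner_eq hqu ⟨hz.1, fun v hv => lt_of_le_of_lt
        (mul_le_mul_of_nonneg_right (le_max_right _ _) hz.1) (hz.2 v hv)⟩
  have hboth : p u * q u / (p u + q u) ≤ (clocks U).real (raceSet u c) := by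
    rw [clocks_real_raceSet _ _ hc0]
    have hb : 1 + ∑ v ∈ univ.filter (· ≠ u), c v ≤ 1 / p u + 1 / q u := by
      have e := Finset.sum_erase_add univ (fun v => p v / p u + q v / q u) (mem_univ u)
      rw [← Finset.filter_ne', Finset.sum_add_distrib (s := univ), ← Finset.sum_div,
        ← Finset.sum_div, hp1, hq1,
        div_self hpu.ne', div_self hqu.ne'] at e
      have : ∑ v ∈ univ.filter (· ≠ u), c v
          ≤ ∑ v ∈ univ.filter (· ≠ u), (p v / p u + q v / q u) :=
        Finset.sum_le_sum fun v _ => max_le_add_of_nonneg (div_nonneg (hp v) hpu.le)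
          (div_nonneg (hq v) hqu.le)
      linarith
    have hpos : 0 < 1 + ∑ v ∈ univ.filter (· ≠ u), c v := by
      have := Finset.sum_nonneg (s := univ.filter (· ≠ u)) fun v _ => hc0 v
      linarith
    calc p u * q u / (p u + q u) = 1 / (1 / p u + 1 / q u) := by field_simp; ring
      _ ≤ _ := one_div_le_one_div_of_le hpos hb
  have hadd : (clocks U).real {z | raceWinner z p = u ∧ raceWinner z q ≠ u}
      + (clocks U).real {z | raceWinner z p = u ∧ raceWinner z q = u} = p u := by
    rw [← clocks_raceWinner p hp hp1 u, add_comm]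
    exact MeasureTheory.measureReal_inter_add_sdiff (s := {z | raceWinner z p = u})
      (measurableSet_raceWinner q u)
  have h2 : (clocks U).real {z | raceWinner z p = u ∧ raceWinner z q ≠ u}
      ≤ p u * (p u / (p u + q u)) := by
    have := MeasureTheory.measureReal_mono (μ := clocks U) hsub
    have e : p u * (p u / (p u + q u)) = p u - p u * q u / (p u + q u) := by field_simp; ring
    linarith
  refine h2.trans (mul_le_mul_of_nonneg_left ?_ hpu.le)
  rcases le_or_gt (p u / q u) 1 with hx | hx
  · calc p u / (p u + q u) ≤ p u / q u := div_le_div_of_nonneg_left hpu.le hqu (by linarith)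
      _ = (p u / q u) ^ (1 : ℝ) := (Real.rpow_one _).symm
      _ ≤ _ := Real.rpow_le_rpow_of_exponent_ge (by positivity) hx h1
  · calc p u / (p u + q u) ≤ 1 := (div_le_one (by linarith)).2 (by linarith)
      _ ≤ _ := Real.one_le_rpow hx.le h0

/-- Matching lemma: a finite family of pmfs can be sampled by common randomness so that two
samples agree whenever one pmf dominates the other at the sampled point. -/
theorem exists_matching {I U : Type} [Fintype I] [Fintype U] [DecidableEq U] [Nonempty U]
    (P : I → U → ℝ)
    (hP : ∀ i u, 0 ≤ P i u) (hP1 : ∀ i, ∑ u, P i u = 1) {lam : ℝ} (h0 : 0 ≤ lam) (h1 : lam ≤ 1) :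
    ∃ (Ω : Type) (_ : Fintype Ω) (ν : Ω → ℝ) (F : Ω → I → U), (∀ ω, 0 ≤ ν ω) ∧ ∑ ω, ν ω = 1 ∧
      (∀ i u, ∑ ω, (if F ω i = u then ν ω else 0) = P i u) ∧
      ∀ i j u, ∑ ω, (if F ω i = u ∧ F ω j ≠ u then ν ω else 0)
        ≤ P i u * mismatch lam (P i u) (P j u) := by
  have key : ∀ (g : (I → U) → Prop) [DecidablePred g], ∑ f, (if g f then
      (clocks U).real ((fun z i => raceWinner z (P i)) ⁻¹' {f}) else 0)
      = (clocks U).real {z | g fun i => raceWinner z (P i)} := by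
    intro g _
    rw [← Finset.sum_filter, MeasureTheory.sum_measureReal_preimage_singleton]
    · congr 1; ext z; simp
    · intro f _
      have : (fun z i => raceWinner z (P i)) ⁻¹' {f} = ⋂ i, {z | raceWinner z (P i) = f i} := by
        ext z; simp [funext_iff]
      rw [this]
      exact MeasurableSet.iInter fun i => measurableSet_raceWinner _ _
  refine ⟨I → U, inferInstance, _, fun f => f, fun f => MeasureTheory.measureReal_nonneg, ?_,
    fun i u => (key _).trans ?_,
    fun i j u => (key _).trans_le ?_⟩
  · simpa using key fun _ => True
  · exact clocks_raceWinner _ (hP i) (hP1 i) u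
  · exact clocks_raceWinner_mismatch _ _ (hP i) (hP1 i) (hP j) (hP1 j) h0 h1 u

lemma IsPmf.pi {A : Type} [Fintype A] {n : ℕ} {p : Fin n → A → ℝ} (hp : ∀ i, IsPmf (p i)) :
    IsPmf (fun a : Fin n → A => ∏ i, p i (a i)) := by
  refine ⟨fun a => Finset.prod_nonneg fun i _ => (hp i).1 _, ?_⟩
  have := Finset.prod_univ_sum (fun _ : Fin n => (univ : Finset A)) p
  rw [Fintype.piFinset_univ] at this
  rw [← this]
  exact Finset.prod_eq_one fun i _ => (hp i).2

lemma exists_le_of_pmf_average {Ω : Type} [Fintype Ω] {ν : Ω → ℝ} (hν : IsPmf ν) {F : Ω → ℝ}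
    {c : ℝ} (h : ∑ ω, ν ω * F ω ≤ c) : ∃ ω, F ω ≤ c := by
  by_contra! hc
  have hne : ∃ ω ∈ univ, ν ω ≠ 0 := by
    by_contra! h0
    have := hν.2
    rw [Finset.sum_eq_zero h0] at this
    exact zero_ne_one this
  obtain ⟨ω, -, hω⟩ := hne
  have : ∑ ω, ν ω * c < ∑ ω, ν ω * F ω :=
    Finset.sum_lt_sum (fun ω _ => mul_le_mul_of_nonneg_left (hc ω).le (hν.1 ω))
      ⟨ω, mem_univ _, mul_lt_mul_of_pos_left (hc ω) (lt_of_le_of_ne (hν.1 ω) (Ne.symm hω))⟩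
  rw [← Finset.sum_mul, hν.2, one_mul] at this
  linarith

/-- States visited by a state machine with transition function `f` driven by inputs `z`. -/
def stateSeq {Λ Z : Type} (f : Λ → Z → Λ) : (n : ℕ) → Λ → (Fin n → Z) → Fin n → Λ
  | 0, _, _ => Fin.elim0
  | n + 1, l, z => Fin.cons l (stateSeq f n (f l (z 0)) (Fin.tail z))

lemma stateSeq_succ {Λ Z : Type} (f : Λ → Z → Λ) (n : ℕ) (l : Λ) (z : Fin (n + 1) → Z)
    (i : Fin n) : stateSeq f (n + 1) l z i.succ
      = f (stateSeq f (n + 1) l z i.castSucc) (z i.castSucc) := by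
  induction n generalizing l with
  | zero => exact i.elim0
  | succ n ih =>
    rw [stateSeq, Fin.cons_succ]
    refine Fin.cases ?_ (fun j => ?_) i
    · simp [stateSeq]
    · rw [ih, ← Fin.succ_castSucc, Fin.cons_succ, Fin.tail]

lemma stateSeq_congr {Λ Z Z' : Type} (f : Λ → Z → Λ) (f' : Λ → Z' → Λ) (n : ℕ) (l : Λ)
    (z : Fin n → Z) (z' : Fin n → Z') (b : Fin n)
    (h : ∀ i, i < b → ∀ l, f l (z i) = f' l (z' i)) :
    stateSeq f n l z b = stateSeq f' n l z' b := by
  induction n generalizing l with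
  | zero => exact b.elim0
  | succ n ih =>
    rw [stateSeq, stateSeq]
    revert h
    refine Fin.cases (fun _ => ?_) (fun j h => ?_) b
    · simp
    · rw [Fin.cons_succ, Fin.cons_succ, h 0 (Fin.succ_pos j)]
      exact ih _ _ _ _ fun i hi l => h i.succ (Fin.succ_lt_succ_iff.2 hi) l

lemma sum_prod_stateSeq {Λ Z : Type} [Fintype Z] (f : Λ → Z → Λ) (n : ℕ)
    (K : Fin n → Λ → Z → ℝ) (hK : ∀ b l, ∑ z, K b l z = 1) (l : Λ) :
    ∑ z : Fin n → Z, ∏ b, K b (stateSeq f n l z b) (z b) = 1 := by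
  induction n generalizing l with
  | zero => simp
  | succ n ih =>
    rw [← (Fin.consEquiv fun _ => Z).sum_comp, Fintype.sum_prod_type]
    simp only [Fin.prod_univ_succ, Fin.consEquiv, Equiv.coe_fn_mk, stateSeq, Fin.cons_zero,
      Fin.cons_succ, Fin.tail_cons]
    simp_rw [← Finset.mul_sum, ih (fun b => K b.succ) fun b l => hK b.succ l, mul_one, hK]

/-- Union bound along the trajectory of a controlled state machine. -/
lemma sum_prod_stateSeq_exists_le {Λ Z : Type} [Fintype Z] (f : Λ → Z → Λ) (n : ℕ)
    (K : Fin n → Λ → Z → ℝ) (hK0 : ∀ b l z, 0 ≤ K b l z) (hK : ∀ b l, ∑ z, K b l z = 1)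
    (bad : Fin n → Λ → Z → Prop) {ε : ℝ}
    (hbad : ∀ b l, ∑ z, K b l z * (if bad b l z then 1 else 0) ≤ ε) (l : Λ) :
    ∑ z : Fin n → Z, (∏ b, K b (stateSeq f n l z b) (z b)) *
      (if ∃ b, bad b (stateSeq f n l z b) (z b) then 1 else 0) ≤ n * ε := by
  induction n generalizing l with
  | zero => simp
  | succ n ih =>
    rw [← (Fin.consEquiv fun _ => Z).sum_comp, Fintype.sum_prod_type]
    simp only [Fin.prod_univ_succ, Fin.consEquiv, Equiv.coe_fn_mk, stateSeq, Fin.cons_zero,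
      Fin.cons_succ, Fin.tail_cons, Fin.exists_fin_succ]
    have step : ∀ z0 : Z, ∑ z : Fin n → Z,
        (K 0 l z0 * ∏ b, K b.succ (stateSeq f n (f l z0) z b) (z b)) *
          (if bad 0 l z0 ∨ ∃ b : Fin n, bad b.succ (stateSeq f n (f l z0) z b) (z b)
            then (1 : ℝ) else 0)
        ≤ K 0 l z0 * (if bad 0 l z0 then 1 else 0) + K 0 l z0 * (n * ε) := by
      intro z0
      have h1 := sum_prod_stateSeq f n (fun b => K b.succ) (fun b l => hK b.succ l) (f l z0)
      have h2 := ih (fun b => K b.succ) (fun b => hK0 b.succ) (fun b l => hK b.succ l)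
        (fun b => bad b.succ) (fun b => hbad b.succ) (f l z0)
      calc _ ≤ ∑ z : Fin n → Z,
            (K 0 l z0 * (if bad 0 l z0 then 1 else 0) *
                (∏ b, K b.succ (stateSeq f n (f l z0) z b) (z b))
              + K 0 l z0 * ((∏ b, K b.succ (stateSeq f n (f l z0) z b) (z b)) *
                (if ∃ b : Fin n, bad b.succ (stateSeq f n (f l z0) z b) (z b) then 1 else 0))) := by
            refine Finset.sum_le_sum fun z _ => ?_
            have a := hK0 0 l z0
            have b : 0 ≤ ∏ b, K b.succ (stateSeq f n (f l z0) z b) (z b) :=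
              Finset.prod_nonneg fun _ _ => hK0 _ _ _
            have ab := mul_nonneg a b
            split_ifs <;> simp_all
        _ ≤ _ := by
            rw [Finset.sum_add_distrib, ← Finset.mul_sum, ← Finset.mul_sum, h1, mul_one]
            exact add_le_add_right (mul_le_mul_of_nonneg_left h2 (hK0 _ _ _)) _
    refine (Finset.sum_le_sum fun z0 _ => step z0).trans ?_
    rw [Finset.sum_add_distrib, ← Finset.sum_mul, hK]
    have := hbad 0 l
    push_cast
    linarith

/-- A triple of sequences is a sequence of triples. -/
def seqTripleEquiv (ι A B C : Type) : (ι → A × B × C) ≃ (ι → A) × (ι → B) × (ι → C) where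
  toFun z := (fun i => (z i).1, fun i => (z i).2.1, fun i => (z i).2.2)
  invFun z := fun i => (z.1 i, z.2.1 i, z.2.2 i)
  left_inv _ := rfl
  right_inv _ := rfl

/-- Block-Markov coding: a randomized one-block scheme, in which the relay carries an index from
each block to the next and the destination recovers both the index and the message of the block,
yields a deterministic code over `B + 1` blocks carrying `B` messages. -/
theorem exists_block_code {X1 X2 Y2 Y3 S Ω Λ Mm : Type} [Fintype Y2] [Fintype Y3]
    [Fintype S] [Fintype Ω] [Fintype Mm] [DecidableEq Λ] [DecidableEq Mm]
    (ν : Ω → ℝ) (hν : IsPmf ν) (pS : S → ℝ) (hpS : IsPmf pS)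
    (W : X1 → X2 → S → Y2 × Y3 → ℝ) (hW : ∀ x1 x2 s, IsPmf (W x1 x2 s))
    (xE : Ω → Mm → X1) (x2E : Ω → S → Λ → X2) (next : Ω → S → Λ → Y2 → Λ)
    (lD : Ω → Y3 → Λ) (wD : Ω → Y3 → Λ → Mm) {ε : ℝ}
    (h : ∀ l w, ∑ ω, ∑ s, ∑ y, ν ω * pS s * W (xE ω w) (x2E ω s l) s y *
      (if lD ω y.2 = l ∧ wD ω y.2 (next ω s l y.1) = w then 0 else 1) ≤ ε)
    (l0 : Λ) (m0 : Mm) (B : ℕ) :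
    ∃ (enc1 : (Fin B → Mm) → Fin (B + 1) → X1)
      (enc2 : (Fin (B + 1) → S) → (Fin (B + 1) → Y2) → Fin (B + 1) → X2)
      (dec : (Fin (B + 1) → Y3) → Fin B → Mm),
      (∀ s y y' b, (∀ i, i < b → y i = y' i) → enc2 s y b = enc2 s y' b) ∧
      ∑ w, ∑ s : Fin (B + 1) → S, ∑ y : Fin (B + 1) → Y2 × Y3,
        (if dec (fun j => (y j).2) = w then 0
        else (Fintype.card (Fin B → Mm) : ℝ)⁻¹ * (∏ j, pS (s j)) *
          ∏ j, W (enc1 w j) (enc2 s (fun i => (y i).1) j) (s j) (y j)) ≤ (B + 1) * ε := by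
  set f : Λ → Ω × S × Y2 → Λ := fun l z => next z.1 z.2.1 l z.2.2 with hf
  set f' : Λ → Ω × S × (Y2 × Y3) → Λ := fun l z => next z.1 z.2.1 l z.2.2.1 with hf'
  set m : (Fin B → Mm) → Fin (B + 1) → Mm := fun w => Fin.snoc (α := fun _ => Mm) w m0 with hm
  set enc1 : (Fin (B + 1) → Ω) → (Fin B → Mm) → Fin (B + 1) → X1 :=
    fun ω w b => xE (ω b) (m w b) with henc1
  set enc2 : (Fin (B + 1) → Ω) → (Fin (B + 1) → S) → (Fin (B + 1) → Y2) → Fin (B + 1) → X2 :=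
    fun ω s y b => x2E (ω b) (s b) (stateSeq f (B + 1) l0 (fun b => (ω b, s b, y b)) b) with henc2
  set dec : (Fin (B + 1) → Ω) → (Fin (B + 1) → Y3) → Fin B → Mm :=
    fun ω y i => wD (ω i.castSucc) (y i.castSucc) (lD (ω i.succ) (y i.succ)) with hdec
  set F : (Fin (B + 1) → Ω) → ℝ := fun ω =>
    ∑ w, ∑ s : Fin (B + 1) → S, ∑ y : Fin (B + 1) → Y2 × Y3,
        (if dec ω (fun j => (y j).2) = w then 0
        else (Fintype.card (Fin B → Mm) : ℝ)⁻¹ * (∏ j, pS (s j)) *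
          ∏ j, W (enc1 ω w j) (enc2 ω s (fun i => (y i).1) j) (s j) (y j)) with hF
  have key : ∀ w, ∑ ω : Fin (B + 1) → Ω, ∑ s : Fin (B + 1) → S, ∑ y : Fin (B + 1) → Y2 × Y3,
      (∏ j, ν (ω j)) * ((∏ j, pS (s j)) *
        (∏ j, W (enc1 ω w j) (enc2 ω s (fun i => (y i).1) j) (s j) (y j)) *
          (if dec ω (fun j => (y j).2) = w then 0 else 1)) ≤ (B + 1) * ε := by
    intro w
    have hc := sum_prod_stateSeq_exists_le f' (B + 1)
      (fun b l z => ν z.1 * pS z.2.1 * W (xE z.1 (m w b)) (x2E z.1 z.2.1 l) z.2.1 z.2.2)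
      (fun b l z => mul_nonneg (mul_nonneg (hν.1 _) (hpS.1 _)) ((hW _ _ _).1 _))
      (fun b l => by
        simp only [Fintype.sum_prod_type (α₁ := Ω), Fintype.sum_prod_type (α₁ := S)]
        simp only [← Finset.mul_sum, (hW _ _ _).2, mul_one, hpS.2, hν.2])
      (fun b l z => ¬ (lD z.1 z.2.2.2 = l ∧ wD z.1 z.2.2.2 (f' l z) = m w b)) (ε := ε)
      (fun b l => by
        simp only [Fintype.sum_prod_type (α₁ := Ω), Fintype.sum_prod_type (α₁ := S)]
        refine le_trans (le_of_eq ?_) (h l (m w b))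
        simp only [hf', ite_not]) l0
    push_cast at hc
    refine le_trans ?_ hc
    rw [← (seqTripleEquiv (Fin (B + 1)) Ω S (Y2 × Y3)).symm.sum_comp]
    simp only [Fintype.sum_prod_type (α₁ := Fin (B + 1) → Ω),
      Fintype.sum_prod_type (α₁ := Fin (B + 1) → S)]
    refine Finset.sum_le_sum fun ω _ => Finset.sum_le_sum fun s _ => Finset.sum_le_sum fun y _ => ?_
    have hst : ∀ b, stateSeq f' (B + 1) l0
        ((seqTripleEquiv (Fin (B + 1)) Ω S (Y2 × Y3)).symm (ω, s, y)) b
        = stateSeq f (B + 1) l0 (fun b => (ω b, s b, (y b).1)) b := fun b =>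
      stateSeq_congr _ _ _ _ _ _ _ fun i _ l => rfl
    rw [Finset.prod_mul_distrib, Finset.prod_mul_distrib]
    simp only [hst]
    have hpos : 0 ≤ (∏ j, ν (ω j)) * (∏ j, pS (s j)) *
        (∏ j, W (enc1 ω w j) (enc2 ω s (fun i => (y i).1) j) (s j) (y j)) :=
      mul_nonneg (mul_nonneg (Finset.prod_nonneg fun _ _ => hν.1 _)
        (Finset.prod_nonneg fun _ _ => hpS.1 _)) (Finset.prod_nonneg fun _ _ => (hW _ _ _).1 _)
    rw [← mul_assoc, ← mul_assoc]
    refine mul_le_mul_of_nonneg_left ?_ hpos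
    by_cases hd : dec ω (fun j => (y j).2) = w
    · simp only [hd, if_true]; split_ifs <;> norm_num
    rw [if_neg hd, if_pos]
    by_contra! hall
    refine hd (funext fun i => ?_)
    have h1 := (hall i.castSucc).2
    have h2 := (hall i.succ).1
    have h3 := hst i.succ
    rw [stateSeq_succ] at h2
    rw [hdec]
    simp only [hm, Fin.snoc_castSucc] at h1
    rw [← h1]
    exact congrArg (wD (ω i.castSucc) ((y i.castSucc).2)) h2
  have havg : ∑ ω : Fin (B + 1) → Ω, (∏ j, ν (ω j)) * F ω ≤ (B + 1) * ε := by
    have e : ∑ ω : Fin (B + 1) → Ω, (∏ j, ν (ω j)) * F ω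
        = ∑ w, (Fintype.card (Fin B → Mm) : ℝ)⁻¹ * ∑ ω : Fin (B + 1) → Ω,
          ∑ s : Fin (B + 1) → S, ∑ y : Fin (B + 1) → Y2 × Y3,
          (∏ j, ν (ω j)) * ((∏ j, pS (s j)) *
          (∏ j, W (enc1 ω w j) (enc2 ω s (fun i => (y i).1) j) (s j) (y j)) *
          (if dec ω (fun j => (y j).2) = w then 0 else 1)) := by
      simp only [hF, Finset.mul_sum]
      rw [Finset.sum_comm]
      refine Finset.sum_congr rfl fun w _ => Finset.sum_congr rfl fun ω _ =>
        Finset.sum_congr rfl fun s _ => Finset.sum_congr rfl fun y _ => ?_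
      split_ifs <;> ring
    rw [e, ← Finset.mul_sum]
    have hle := Finset.sum_le_sum (s := univ) fun w (_ : w ∈ univ) => key w
    rw [Finset.sum_const, nsmul_eq_mul, Finset.card_univ] at hle
    have : Nonempty Mm := ⟨m0⟩
    have hcard : (0 : ℝ) < Fintype.card (Fin B → Mm) := by exact_mod_cast Fintype.card_pos
    refine (mul_le_mul_of_nonneg_left hle (inv_nonneg.2 hcard.le)).trans (le_of_eq ?_)
    rw [← mul_assoc, inv_mul_cancel₀ hcard.ne', one_mul]
  obtain ⟨ω, hω⟩ := exists_le_of_pmf_average (IsPmf.pi fun _ => hν) havg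
  refine ⟨enc1 ω, enc2 ω, dec ω, fun s y y' b hb => ?_, hω⟩
  simp only [henc2]
  congr 1
  exact stateSeq_congr _ _ _ _ _ _ _ fun i hi l => by simp only [hb i hi]

lemma sum_ite_le_sum_ite {Ω : Type} [Fintype Ω] {ν : Ω → ℝ} (hν : ∀ ω, 0 ≤ ν ω)
    {p q : Ω → Prop} [DecidablePred p] [DecidablePred q] (h : ∀ ω, p ω → q ω) :
    ∑ ω, (if p ω then ν ω else 0) ≤ ∑ ω, (if q ω then ν ω else 0) := by
  refine Finset.sum_le_sum fun ω _ => ?_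
  by_cases hp : p ω
  · rw [if_pos hp, if_pos (h ω hp)]
  · rw [if_neg hp]; split_ifs <;> simp [hν]

lemma sum_ite_fst_eq {Ω A B : Type} [Fintype Ω] [Fintype B] [DecidableEq A] [DecidableEq B]
    (ν : Ω → ℝ) (X : Ω → A × B) (a : A) (p : Ω → Prop) [DecidablePred p] :
    ∑ ω, (if (X ω).1 = a ∧ p ω then ν ω else 0)
      = ∑ b, ∑ ω, (if X ω = (a, b) ∧ p ω then ν ω else 0) := by
  rw [Finset.sum_comm]
  refine Finset.sum_congr rfl fun ω _ => ?_
  by_cases h1 : (X ω).1 = a <;> by_cases h2 : p ω <;> simp [Prod.ext_iff, h1, h2]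

lemma exists_kernel_coupling {A B : Type} [Fintype A] [Fintype B] [Nonempty B] (p : A → B → ℝ)
    (hp : IsKernel p) :
    ∃ (Ω : Type) (_ : Fintype Ω) (ν : Ω → ℝ) (E : Ω → A → B), IsPmf ν ∧
      ∀ a b, ∑ ω, (if E ω a = b then ν ω else 0) = p a b := by
  obtain ⟨Ω, _, ν, F, h0, h1, h2, -⟩ := exists_matching p (fun i => (hp i).1) (fun i => (hp i).2)
    zero_le_one le_rfl
  exact ⟨Ω, _, ν, F, ⟨h0, h1⟩, h2⟩

lemma sum_point_mul {A : Type} [Fintype A] {L : ℕ} (p : A → ℝ) (l : Fin L) :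
    ∑ u : A × Fin L, (if u.2 = l then p u.1 else 0) = ∑ a, p a := by
  rw [Fintype.sum_prod_type]
  simp

lemma sum_unif_mul {A : Type} [Fintype A] {L : ℕ} (hL : 0 < L) (p : A → ℝ) :
    ∑ u : A × Fin L, p u.1 / L = ∑ a, p a := by
  have : (L : ℝ) ≠ 0 := by positivity
  rw [Fintype.sum_prod_type]
  simp only [Finset.sum_const, Finset.card_univ, Fintype.card_fin, nsmul_eq_mul]
  exact Finset.sum_congr rfl fun a _ => by field_simp

/-- Gel'fand–Pinsker coupling: the encoder sees `s` and an index, the decoder sees `y` and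
recovers both the codeword and the index. -/
lemma exists_indexed_coupling {S Q Y : Type} [Fintype S] [Fintype Q] [Fintype Y] [Nonempty Q]
    {L : ℕ} (hL : 0 < L) (pQ : S → Q → ℝ) (hpQ : IsKernel pQ) (r : Y → Q → ℝ) (hr : IsKernel r)
    {lam : ℝ} (h0 : 0 ≤ lam) (h1 : lam ≤ 1) :
    ∃ (Ω : Type) (_ : Fintype Ω) (ν : Ω → ℝ) (E : Ω → S → Fin L → Q) (D : Ω → Y → Q × Fin L),
      IsPmf ν ∧ (∀ s l q, ∑ ω, (if E ω s l = q then ν ω else 0) = pQ s q) ∧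
      ∀ s l q y, ∑ ω, (if E ω s l = q ∧ D ω y ≠ (q, l) then ν ω else 0)
        ≤ pQ s q * mismatch lam (pQ s q) (r y q / L) := by
  have : Nonempty (Fin L) := ⟨⟨0, hL⟩⟩
  obtain ⟨Ω, _, ν, F, n0, n1, n2, n3⟩ := exists_matching (I := (S × Fin L) ⊕ Y) (U := Q × Fin L)
    (Sum.elim (fun a u => if u.2 = a.2 then pQ a.1 u.1 else 0) (fun y u => r y u.1 / L))
    (by
      rintro (a | y) u
      · simp only [Sum.elim_inl]; split_ifs
        exacts [(hpQ _).1 _, le_rfl]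
      · exact div_nonneg ((hr _).1 _) (Nat.cast_nonneg _))
    (by
      rintro (a | y)
      · exact (sum_point_mul _ _).trans (hpQ _).2
      · exact (sum_unif_mul hL _).trans (hr _).2) h0 h1
  refine ⟨Ω, _, ν, fun f s l => (F f (Sum.inl (s, l))).1, fun f y => F f (Sum.inr y),
    ⟨n0, n1⟩, ?_, ?_⟩
  · intro s l q
    beta_reduce
    have := sum_ite_fst_eq ν (fun f => F f (Sum.inl (s, l))) q (fun _ => True)
    simp only [and_true] at this
    rw [this]
    simp only [n2, Sum.elim_inl]
    simp
  · intro s l q y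
    beta_reduce
    rw [sum_ite_fst_eq ν (fun f => F f (Sum.inl (s, l))) q (fun f => F f (Sum.inr y) ≠ (q, l))]
    have hz : ∀ l' ∈ univ, l' ≠ l → ∑ f, (if F f (Sum.inl (s, l)) = (q, l') ∧
        F f (Sum.inr y) ≠ (q, l) then ν f else 0) = 0 := by
      intro l' _ hl'
      refine le_antisymm ?_ (Finset.sum_nonneg fun f _ => by split_ifs <;> simp [n0])
      refine (sum_ite_le_sum_ite n0 (q := fun f => F f (Sum.inl (s, l)) = (q, l'))
        fun f hf => hf.1).trans ?_
      rw [n2]; simp [hl']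
    rw [Finset.sum_eq_single l hz (by simp)]
    refine (n3 (Sum.inl (s, l)) (Sum.inr y) (q, l)).trans ?_
    simp

/-- Source coupling: the message index is recovered from the observation of the decoder. -/
lemma exists_source_coupling {X Y : Type} [Fintype X] [Fintype Y] [Nonempty X] {M : ℕ} (hM : 0 < M)
    (pX : X → ℝ) (hpX : IsPmf pX) (r : Y → X → ℝ) (hr : IsKernel r)
    {lam : ℝ} (h0 : 0 ≤ lam) (h1 : lam ≤ 1) :
    ∃ (Ω : Type) (_ : Fintype Ω) (ν : Ω → ℝ) (E : Ω → Fin M → X) (D : Ω → Y → Fin M),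
      IsPmf ν ∧ (∀ m x, ∑ ω, (if E ω m = x then ν ω else 0) = pX x) ∧
      ∀ m x y, ∑ ω, (if E ω m = x ∧ D ω y ≠ m then ν ω else 0)
        ≤ pX x * mismatch lam (pX x) (r y x / M) := by
  obtain ⟨Ω, _, ν, E, D, hν, hE, hD⟩ :=
    exists_indexed_coupling hM (fun _ : Unit => pX) (fun _ => hpX) r hr h0 h1
  refine ⟨Ω, _, ν, fun ω => E ω (), fun ω y => (D ω y).2, hν, fun m x => hE () m x,
    fun m x y => le_trans ?_ (hD () m x y)⟩
  refine sum_ite_le_sum_ite hν.1 fun ω hω => ⟨hω.1, fun h => hω.2 ?_⟩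
  exact congrArg Prod.snd h

/-- Wyner–Ziv coupling: the encoder describes its sample by an index, from which the decoder
recovers the sample with the help of its side information. -/
lemma exists_binning_coupling {A H Y : Type} [Fintype A] [Fintype H] [Fintype Y] [Nonempty H]
    {L : ℕ} (hL : 0 < L) (pH : A → H → ℝ) (hpH : IsKernel pH) (r : Y → H → ℝ) (hr : IsKernel r)
    {lam : ℝ} (h0 : 0 ≤ lam) (h1 : lam ≤ 1) :
    ∃ (Ω : Type) (_ : Fintype Ω) (ν : Ω → ℝ) (E : Ω → A → H × Fin L) (D : Ω → Y → Fin L → H),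
      IsPmf ν ∧ (∀ a h, ∑ ω, (if (E ω a).1 = h then ν ω else 0) = pH a h) ∧
      ∀ a h y, ∑ ω, (if (E ω a).1 = h ∧ D ω y (E ω a).2 ≠ h then ν ω else 0)
        ≤ pH a h * mismatch lam (pH a h / L) (r y h) := by
  have : Nonempty (Fin L) := ⟨⟨0, hL⟩⟩
  have hL0 : (L : ℝ) ≠ 0 := by positivity
  obtain ⟨Ω, _, ν, F, n0, n1, n2, n3⟩ := exists_matching (I := A ⊕ (Y × Fin L)) (U := H × Fin L)
    (Sum.elim (fun a u => pH a u.1 / L) (fun y u => if u.2 = y.2 then r y.1 u.1 else 0))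
    (by
      rintro (a | y) u
      · exact div_nonneg ((hpH _).1 _) (Nat.cast_nonneg _)
      · simp only [Sum.elim_inr]; split_ifs
        exacts [(hr _).1 _, le_rfl])
    (by
      rintro (a | y)
      · exact (sum_unif_mul hL _).trans (hpH _).2
      · exact (sum_point_mul _ _).trans (hr _).2) h0 h1
  refine ⟨Ω, _, ν, fun f a => F f (Sum.inl a), fun f y l => (F f (Sum.inr (y, l))).1,
    ⟨n0, n1⟩, ?_, ?_⟩
  · intro a h
    beta_reduce
    have := sum_ite_fst_eq ν (fun f => F f (Sum.inl a)) h (fun _ => True)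
    simp only [and_true] at this
    rw [this]
    simp only [n2, Sum.elim_inl, Finset.sum_const, Finset.card_univ, Fintype.card_fin, nsmul_eq_mul]
    field_simp
  · intro a h y
    beta_reduce
    rw [sum_ite_fst_eq ν (fun f => F f (Sum.inl a)) h
      (fun f => (F f (Sum.inr (y, (F f (Sum.inl a)).2))).1 ≠ h)]
    have hl : ∀ l ∈ univ, ∑ f, (if F f (Sum.inl a) = (h, l) ∧
        (F f (Sum.inr (y, (F f (Sum.inl a)).2))).1 ≠ h then ν f else 0)
        ≤ pH a h / L * mismatch lam (pH a h / L) (r y h) := by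
      intro l _
      refine (sum_ite_le_sum_ite n0 (q := fun f => F f (Sum.inl a) = (h, l) ∧
        F f (Sum.inr (y, l)) ≠ (h, l)) fun f hf => ⟨hf.1, fun hc => ?_⟩).trans
        ((n3 (Sum.inl a) (Sum.inr (y, l)) (h, l)).trans ?_)
      · rw [hf.1] at hf
        exact hf.2 (by rw [hc])
      · simp
    refine (Finset.sum_le_sum hl).trans (le_of_eq ?_)
    simp only [Finset.sum_const, Finset.card_univ, Fintype.card_fin, nsmul_eq_mul]
    field_simp

lemma sum_pushforward {Ω A : Type} [Fintype Ω] [Fintype A] (X : Ω → A) (a : Ω → ℝ)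
    (t : Ω → A → ℝ) (V : A → ℝ) :
    ∑ ω, a ω * t ω (X ω) * V (X ω)
      = ∑ x, (∑ ω, if X ω = x then a ω * t ω x else 0) * V x := by
  simp only [Finset.sum_mul, ite_mul, zero_mul]
  rw [Finset.sum_comm]
  simp

/-- Reordering of the summation over the sample space of the relay channel. -/
def relaySampleEquiv (S Q X1 X2 Y2 Y3 H : Type) :
    ΩRCrel S Q X1 X2 Y2 Y3 H ≃ S × (Y2 × Y3) × Q × X2 × H × X1 where
  toFun ω := (vS ω, (vY2 ω, vY3 ω), vQ2 ω, vX2 ω, vYH ω, vX1 ω)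
  invFun z := (z.1, z.2.2.1, z.2.2.2.2.2, z.2.2.2.1, z.2.1.1, z.2.1.2, z.2.2.2.2.1)
  left_inv _ := rfl
  right_inv _ := rfl

/-- Joint pmf of the relay channel with auxiliary variables. -/
def relayPmf {S Q X1 X2 Y2 Y3 H : Type} (pS : S → ℝ) (pQ : S → Q → ℝ) (pX2 : Q × S → X2 → ℝ)
    (pX1 : X1 → ℝ) (W : X1 → X2 → S → Y2 × Y3 → ℝ) (pH : Y2 × Q × S → H → ℝ)
    (ω : ΩRCrel S Q X1 X2 Y2 Y3 H) : ℝ :=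
  pS (vS ω) * pQ (vS ω) (vQ2 ω) * pX2 (vQ2 ω, vS ω) (vX2 ω) * pX1 (vX1 ω) *
    W (vX1 ω) (vX2 ω) (vS ω) (vY2 ω, vY3 ω) * pH (vY2 ω, vQ2 ω, vS ω) (vYH ω)

/-- One-shot compress–forward with Gel'fand–Pinsker coding: the error of one block is bounded by
the expected mismatch of the three couplings. -/
theorem oneBlock_error_le {S Q X1 X2 Y2 Y3 H Λ Mm ΩG ΩK ΩH ΩX : Type} [Fintype S] [Fintype Q]
    [Fintype X1] [Fintype X2] [Fintype Y2] [Fintype Y3] [Fintype H]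
    [Fintype ΩG] [Fintype ΩK] [Fintype ΩH] [Fintype ΩX] [DecidableEq Λ] [DecidableEq Mm]
    (pS : S → ℝ) (hpS : IsPmf pS) (pQ : S → Q → ℝ)
    (pX2 : Q × S → X2 → ℝ) (hpX2 : IsKernel pX2) (pX1 : X1 → ℝ) (hpX1 : IsPmf pX1)
    (W : X1 → X2 → S → Y2 × Y3 → ℝ) (hW : ∀ x1 x2 s, IsPmf (W x1 x2 s))
    (pH : Y2 × Q × S → H → ℝ) (hpH : IsKernel pH) (hpQ : IsKernel pQ)
    (eG : S → Q → Y3 → ℝ) (eH : Y2 × Q × S → Y3 → H → ℝ) (eX : X1 → Q → H → Y3 → ℝ)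
    (νG : ΩG → ℝ) (gE : ΩG → S → Λ → Q) (gD : ΩG → Y3 → Q × Λ) (hG : IsPmf νG)
    (mG : ∀ s l q, ∑ ω, (if gE ω s l = q then νG ω else 0) = pQ s q)
    (bG : ∀ s l q y, ∑ ω, (if gE ω s l = q ∧ gD ω y ≠ (q, l) then νG ω else 0)
      ≤ pQ s q * eG s q y)
    (νK : ΩK → ℝ) (kE : ΩK → Q × S → X2) (hK : IsPmf νK)
    (mK : ∀ a x, ∑ ω, (if kE ω a = x then νK ω else 0) = pX2 a x)
    (νH : ΩH → ℝ) (hE : ΩH → Y2 × Q × S → H × Λ) (hD : ΩH → Q × Y3 → Λ → H) (hH : IsPmf νH)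
    (mH : ∀ a h, ∑ ω, (if (hE ω a).1 = h then νH ω else 0) = pH a h)
    (bH : ∀ a h y, ∑ ω, (if (hE ω a).1 = h ∧ hD ω (a.2.1, y) (hE ω a).2 ≠ h then νH ω else 0)
      ≤ pH a h * eH a y h)
    (νX : ΩX → ℝ) (xE : ΩX → Mm → X1) (xD : ΩX → Q × H × Y3 → Mm) (hX : IsPmf νX)
    (mX : ∀ m x, ∑ ω, (if xE ω m = x then νX ω else 0) = pX1 x)
    (bX : ∀ m x q h y, ∑ ω, (if xE ω m = x ∧ xD ω (q, h, y) ≠ m then νX ω else 0)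
      ≤ pX1 x * eX x q h y) (l : Λ) (m : Mm) :
    ∑ ω : ΩG × ΩK × ΩH × ΩX, ∑ s, ∑ y, (νG ω.1 * νK ω.2.1 * νH ω.2.2.1 * νX ω.2.2.2) * pS s *
      W (xE ω.2.2.2 m) (kE ω.2.1 (gE ω.1 s l, s)) s y *
      (if (gD ω.1 y.2).2 = l ∧
        xD ω.2.2.2 ((gD ω.1 y.2).1,
          hD ω.2.2.1 ((gD ω.1 y.2).1, y.2) (hE ω.2.2.1 (y.1, gE ω.1 s l, s)).2, y.2) = m
        then 0 else 1)
    ≤ ∑ ω : ΩRCrel S Q X1 X2 Y2 Y3 H, relayPmf pS pQ pX2 pX1 W pH ω *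
      (eG (vS ω) (vQ2 ω) (vY3 ω) + eH (vY2 ω, vQ2 ω, vS ω) (vY3 ω) (vYH ω)
        + eX (vX1 ω) (vQ2 ω) (vYH ω) (vY3 ω)) := by
  have nested : ∀ (s : S) (y : Y2 × Y3) (tg : ΩG → Q → ℝ) (th : ΩH → Q → H → ℝ)
      (tx : ΩX → Q → H → X1 → ℝ),
      ∑ g, νG g * tg g (gE g s l) * ∑ k, νK k * 1 * ∑ h,
        νH h * th h (gE g s l) (hE h (y.1, gE g s l, s)).1 * ∑ x,
        νX x * tx x (gE g s l) (hE h (y.1, gE g s l, s)).1 (xE x m) *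
          W (xE x m) (kE k (gE g s l, s)) s y
      = ∑ q, (∑ g, if gE g s l = q then νG g * tg g q else 0) *
        ∑ x2, (∑ k, if kE k (q, s) = x2 then νK k * 1 else 0) *
        ∑ c, (∑ h, if (hE h (y.1, q, s)).1 = c then νH h * th h q c else 0) *
        ∑ x1, (∑ x, if xE x m = x1 then νX x * tx x q c x1 else 0) * W x1 x2 s y := by
    intro s y tg th tx
    have e1 : ∀ q x2 c, ∑ x, νX x * tx x q c (xE x m) * W (xE x m) x2 s y = _ := fun q x2 c =>
      sum_pushforward (fun x => xE x m) νX (fun x x1 => tx x q c x1) (fun x1 => W x1 x2 s y)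
    simp only [e1]
    have e2 : ∀ q (V : H → ℝ), ∑ h, νH h * th h q (hE h (y.1, q, s)).1 * V (hE h (y.1, q, s)).1
        = _ := fun q V =>
      sum_pushforward (fun h => (hE h (y.1, q, s)).1) νH (fun h c => th h q c) V
    have e2' := fun q x2 => e2 q (fun c =>
      ∑ x1, (∑ x, if xE x m = x1 then νX x * tx x q c x1 else 0) * W x1 x2 s y)
    simp only [e2']
    have e3 := fun q => sum_pushforward (fun k => kE k (q, s)) νK (fun _ _ => 1) (fun x2 =>
        ∑ c, (∑ h, if (hE h (y.1, q, s)).1 = c then νH h * th h q c else 0) *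
        ∑ x1, (∑ x, if xE x m = x1 then νX x * tx x q c x1 else 0) * W x1 x2 s y)
    simp only [e3]
    exact sum_pushforward (fun g => gE g s l) νG tg (fun q =>
      ∑ x2, (∑ k, if kE k (q, s) = x2 then νK k * 1 else 0) *
        ∑ c, (∑ h, if (hE h (y.1, q, s)).1 = c then νH h * th h q c else 0) *
        ∑ x1, (∑ x, if xE x m = x1 then νX x * tx x q c x1 else 0) * W x1 x2 s y)
  have mono : ∀ (s : S) (y : Y2 × Y3) (A B : Q → ℝ) (C D : Q → H → ℝ) (E F : Q → H → X1 → ℝ),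
      (∀ q, 0 ≤ A q) → (∀ q, A q ≤ B q) → (∀ q c, 0 ≤ C q c) → (∀ q c, C q c ≤ D q c) →
      (∀ q c x, 0 ≤ E q c x) → (∀ q c x, E q c x ≤ F q c x) →
      ∑ q, A q * ∑ x2, pX2 (q, s) x2 * ∑ c, C q c * ∑ x1, E q c x1 * W x1 x2 s y
      ≤ ∑ q, B q * ∑ x2, pX2 (q, s) x2 * ∑ c, D q c * ∑ x1, F q c x1 * W x1 x2 s y := by
    intro s y A B C D E F hA hAB hC hCD hEE hEF
    have w0 : ∀ x1 x2, 0 ≤ W x1 x2 s y := fun x1 x2 => (hW _ _ _).1 _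
    have i1 : ∀ q c x2, 0 ≤ ∑ x1, E q c x1 * W x1 x2 s y := fun q c x2 =>
      Finset.sum_nonneg fun x1 _ => mul_nonneg (hEE _ _ _) (w0 _ _)
    have i2 : ∀ q x2, 0 ≤ ∑ c, C q c * ∑ x1, E q c x1 * W x1 x2 s y := fun q x2 =>
      Finset.sum_nonneg fun c _ => mul_nonneg (hC _ _) (i1 _ _ _)
    have i3 : ∀ q, 0 ≤ ∑ x2, pX2 (q, s) x2 * ∑ c, C q c * ∑ x1, E q c x1 * W x1 x2 s y := fun q =>
      Finset.sum_nonneg fun x2 _ => mul_nonneg ((hpX2 _).1 _) (i2 _ _)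
    refine Finset.sum_le_sum fun q _ => mul_le_mul (hAB q) ?_ (i3 q) ((hA q).trans (hAB q))
    refine Finset.sum_le_sum fun x2 _ => mul_le_mul_of_nonneg_left ?_ ((hpX2 _).1 _)
    refine Finset.sum_le_sum fun c _ => mul_le_mul (hCD q c) ?_ (i1 _ _ _)
      ((hC q c).trans (hCD q c))
    exact Finset.sum_le_sum fun x1 _ => mul_le_mul_of_nonneg_right (hEF _ _ _) (w0 _ _)
  have ind : ∀ (p : Prop) [Decidable p] (a : ℝ),
      a * (if p then (1 : ℝ) else 0) = if p then a else 0 := by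
    intro p _ a; split_ifs <;> simp
  have n0 : ∀ {Ω : Type} [Fintype Ω] {ν : Ω → ℝ} (_ : IsPmf ν) (p : Ω → Prop)
      [DecidablePred p],
      0 ≤ ∑ ω, (if p ω then ν ω else 0) := fun h p _ =>
    Finset.sum_nonneg fun ω _ => by split_ifs <;> simp [h.1]
  have NG : ∀ (s : S) (y : Y2 × Y3), _ ≤ _ := fun s y =>
    (nested s y (fun g q => if gD g y.2 ≠ (q, l) then 1 else 0) (fun _ _ _ => 1)
      (fun _ _ _ _ => 1)).trans_le (by
      simp only [ind, mul_one, ← ite_and, mK, mH, mX]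
      exact mono s y _ (fun q => pQ s q * eG s q y.2) _ (fun q c => pH (y.1, q, s) c) _
        (fun q c x => pX1 x) (fun q => n0 hG _) (fun q => bG s l q y.2) (fun q c => (hpH _).1 _)
        (fun _ _ => le_rfl) (fun _ _ _ => hpX1.1 _) (fun _ _ _ => le_rfl))
  have NH : ∀ (s : S) (y : Y2 × Y3), _ ≤ _ := fun s y =>
    (nested s y (fun _ _ => 1)
      (fun h q c => if hD h (q, y.2) (hE h (y.1, q, s)).2 ≠ c then 1 else 0)
      (fun _ _ _ _ => 1)).trans_le (by
      simp only [ind, mul_one, ← ite_and, mK, mG, mX]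
      exact mono s y _ (fun q => pQ s q) _ (fun q c => pH (y.1, q, s) c * eH (y.1, q, s) y.2 c) _
        (fun q c x => pX1 x) (fun q => (hpQ _).1 _) (fun _ => le_rfl) (fun q c => n0 hH _)
        (fun q c => bH (y.1, q, s) c y.2) (fun _ _ _ => hpX1.1 _) (fun _ _ _ => le_rfl))
  have NX : ∀ (s : S) (y : Y2 × Y3), _ ≤ _ := fun s y =>
    (nested s y (fun _ _ => 1) (fun _ _ _ => 1)
      (fun x q c x1 => if xD x (q, c, y.2) ≠ m then 1 else 0)).trans_le (by
      simp only [ind, mul_one, ← ite_and, mK, mG, mH]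
      exact mono s y _ (fun q => pQ s q) _ (fun q c => pH (y.1, q, s) c) _
        (fun q c x => pX1 x * eX x q c y.2) (fun q => (hpQ _).1 _) (fun _ => le_rfl)
        (fun q c => (hpH _).1 _) (fun _ _ => le_rfl)
        (fun q c x => n0 hX _) (fun q c x => bX m x q c y.2))
  calc _ = ∑ s, ∑ y, pS s * ∑ ω : ΩG × ΩK × ΩH × ΩX,
        (νG ω.1 * νK ω.2.1 * νH ω.2.2.1 * νX ω.2.2.2) *
        W (xE ω.2.2.2 m) (kE ω.2.1 (gE ω.1 s l, s)) s y *
        (if (gD ω.1 y.2).2 = l ∧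
          xD ω.2.2.2 ((gD ω.1 y.2).1,
            hD ω.2.2.1 ((gD ω.1 y.2).1, y.2) (hE ω.2.2.1 (y.1, gE ω.1 s l, s)).2, y.2) = m
          then 0 else 1) := by
        rw [Finset.sum_comm]
        refine Finset.sum_congr rfl fun s _ => ?_
        rw [Finset.sum_comm]
        refine Finset.sum_congr rfl fun y _ => ?_
        rw [Finset.mul_sum]
        exact Finset.sum_congr rfl fun ω _ => by ring
    _ ≤ ∑ s, ∑ y : Y2 × Y3, pS s * (_ + _ + _) := by
        refine Finset.sum_le_sum fun s _ => Finset.sum_le_sum fun y _ =>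
          mul_le_mul_of_nonneg_left ?_ (hpS.1 _)
        refine le_trans ?_ (add_le_add (add_le_add (NG s y) (NH s y)) (NX s y))
        simp only [Fintype.sum_prod_type (α₁ := ΩG), Fintype.sum_prod_type (α₁ := ΩK),
          Fintype.sum_prod_type (α₁ := ΩH), Finset.mul_sum, ← Finset.sum_add_distrib]
        refine Finset.sum_le_sum fun g _ => Finset.sum_le_sum fun k _ =>
          Finset.sum_le_sum fun h _ => Finset.sum_le_sum fun x _ => ?_
        have hpos : 0 ≤ νG g * νK k * νH h * νX x * W (xE x m) (kE k (gE g s l, s)) s y :=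
          mul_nonneg (mul_nonneg (mul_nonneg (mul_nonneg (hG.1 _) (hK.1 _)) (hH.1 _)) (hX.1 _))
            ((hW _ _ _).1 _)
        have hb : (if (gD g y.2).2 = l ∧ xD x ((gD g y.2).1,
            hD h ((gD g y.2).1, y.2) (hE h (y.1, gE g s l, s)).2, y.2) = m then (0 : ℝ) else 1)
            ≤ (if gD g y.2 ≠ (gE g s l, l) then 1 else 0)
            + (if hD h (gE g s l, y.2) (hE h (y.1, gE g s l, s)).2
                ≠ (hE h (y.1, gE g s l, s)).1 then 1 else 0)
            + (if xD x (gE g s l, (hE h (y.1, gE g s l, s)).1, y.2) ≠ m then 1 else 0) := by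
          by_cases c1 : gD g y.2 = (gE g s l, l)
          · by_cases c2 : hD h (gE g s l, y.2) (hE h (y.1, gE g s l, s)).2
                = (hE h (y.1, gE g s l, s)).1
            · simp [c1, c2]
            · rw [if_pos c2]
              split_ifs <;> norm_num
          · rw [if_pos c1]
            split_ifs <;> norm_num
        refine (mul_le_mul_of_nonneg_left hb hpos).trans (le_of_eq ?_)
        ring
    _ = _ := by
        rw [← (relaySampleEquiv S Q X1 X2 Y2 Y3 H).symm.sum_comp]
        simp only [Fintype.sum_prod_type (α₁ := S), Fintype.sum_prod_type (α₁ := Y2 × Y3),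
          Fintype.sum_prod_type (α₁ := Q), Fintype.sum_prod_type (α₁ := X2),
          Fintype.sum_prod_type (α₁ := H), Finset.mul_sum, ← Finset.sum_add_distrib]
        refine Finset.sum_congr rfl fun s _ => Finset.sum_congr rfl fun y _ =>
          Finset.sum_congr rfl fun q _ => Finset.sum_congr rfl fun x2 _ =>
          Finset.sum_congr rfl fun c _ => Finset.sum_congr rfl fun x1 _ => ?_
        simp only [relayPmf, relaySampleEquiv, Equiv.coe_fn_symm_mk, vS, vQ2, vX1, vX2, vY2, vY3,
          vYH]
        ring

lemma IsPmf.prod {A B : Type} [Fintype A] [Fintype B] {p : A → ℝ} {q : B → ℝ} (hp : IsPmf p)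
    (hq : IsPmf q) : IsPmf (fun z : A × B => p z.1 * q z.2) := by
  refine ⟨fun z => mul_nonneg (hp.1 _) (hq.1 _), ?_⟩
  rw [Fintype.sum_prod_type]
  simp only [← Finset.mul_sum, hq.2, hp.2, mul_one]

lemma IsPmf.nonempty {A : Type} [Fintype A] {p : A → ℝ} (hp : IsPmf p) : Nonempty A := by
  by_contra h
  rw [not_nonempty_iff] at h
  simpa using hp.2

/-- Compress–forward codes over `B + 1` blocks, each block being treated as a single letter. -/
theorem exists_compressForward_code {S Q X1 X2 Y2 Y3 H : Type} [Fintype S] [Fintype Q]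
    [Fintype X1] [Fintype X2] [Fintype Y2] [Fintype Y3] [Fintype H]
    (pS : S → ℝ) (hpS : IsPmf pS) (pQ : S → Q → ℝ) (hpQ : IsKernel pQ)
    (pX2 : Q × S → X2 → ℝ) (hpX2 : IsKernel pX2) (pX1 : X1 → ℝ) (hpX1 : IsPmf pX1)
    (W : X1 → X2 → S → Y2 × Y3 → ℝ) (hW : ∀ x1 x2 s, IsPmf (W x1 x2 s))
    (pH : Y2 × Q × S → H → ℝ) (hpH : IsKernel pH)
    (rG : Y3 → Q → ℝ) (hrG : IsKernel rG) (rH : Q × Y3 → H → ℝ) (hrH : IsKernel rH)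
    (rX : Q × H × Y3 → X1 → ℝ) (hrX : IsKernel rX) {L M : ℕ} (hL : 0 < L) (hM : 0 < M)
    {lamG lamH lamX : ℝ} (hG0 : 0 ≤ lamG) (hG1 : lamG ≤ 1) (hH0 : 0 ≤ lamH) (hH1 : lamH ≤ 1)
    (hX0 : 0 ≤ lamX) (hX1 : lamX ≤ 1) (B : ℕ) :
    ∃ (enc1 : (Fin B → Fin M) → Fin (B + 1) → X1)
      (enc2 : (Fin (B + 1) → S) → (Fin (B + 1) → Y2) → Fin (B + 1) → X2)
      (dec : (Fin (B + 1) → Y3) → Fin B → Fin M),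
      (∀ s y y' b, (∀ i, i < b → y i = y' i) → enc2 s y b = enc2 s y' b) ∧
      ∑ w, ∑ s : Fin (B + 1) → S, ∑ y : Fin (B + 1) → Y2 × Y3,
        (if dec (fun j => (y j).2) = w then 0
        else (Fintype.card (Fin B → Fin M) : ℝ)⁻¹ * (∏ j, pS (s j)) *
          ∏ j, W (enc1 w j) (enc2 s (fun i => (y i).1) j) (s j) (y j)) ≤
      (B + 1) * ∑ ω : ΩRCrel S Q X1 X2 Y2 Y3 H, relayPmf pS pQ pX2 pX1 W pH ω *
        (mismatch lamG (pQ (vS ω) (vQ2 ω)) (rG (vY3 ω) (vQ2 ω) / L)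
          + mismatch lamH (pH (vY2 ω, vQ2 ω, vS ω) (vYH ω) / L) (rH (vQ2 ω, vY3 ω) (vYH ω))
          + mismatch lamX (pX1 (vX1 ω)) (rX (vQ2 ω, vYH ω, vY3 ω) (vX1 ω) / M)) := by
  have s0 : S := hpS.nonempty.some
  have x0 : X1 := hpX1.nonempty.some
  have q0 : Q := (hpQ s0).nonempty.some
  have x20 : X2 := (hpX2 (q0, s0)).nonempty.some
  have y0 : Y2 × Y3 := (hW x0 x20 s0).nonempty.some
  have : Nonempty X1 := ⟨x0⟩
  have : Nonempty Q := ⟨q0⟩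
  have : Nonempty X2 := ⟨x20⟩
  have : Nonempty H := (hpH (y0.1, q0, s0)).nonempty
  obtain ⟨ΩG, _, νG, gE, gD, hG, mG, bG⟩ := exists_indexed_coupling hL pQ hpQ rG hrG hG0 hG1
  obtain ⟨ΩK, _, νK, kE, hK, mK⟩ := exists_kernel_coupling pX2 hpX2
  obtain ⟨ΩH, _, νH, hE, hD, hH, mH, bH⟩ := exists_binning_coupling hL pH hpH rH hrH hH0 hH1
  obtain ⟨ΩX, _, νX, xE, xD, hX, mX, bX⟩ := exists_source_coupling hM pX1 hpX1 rX hrX hX0 hX1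
  have hν : IsPmf fun ω : ΩG × ΩK × ΩH × ΩX => νG ω.1 * νK ω.2.1 * νH ω.2.2.1 * νX ω.2.2.2 := by
    have := hG.prod (hK.prod (hH.prod hX))
    simpa only [mul_assoc] using this
  have hb := fun l m => oneBlock_error_le pS hpS pQ pX2 hpX2 pX1 hpX1 W hW pH hpH hpQ
    (fun s q y => mismatch lamG (pQ s q) (rG y q / L))
    (fun a y h => mismatch lamH (pH a h / L) (rH (a.2.1, y) h))
    (fun x q h y => mismatch lamX (pX1 x) (rX (q, h, y) x / M))
    νG gE gD hG mG bG νK kE hK mK νH hE hD hH mH (fun a h y => bH a h (a.2.1, y))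
    νX xE xD hX mX (fun m x q h y => bX m x (q, h, y)) l m
  exact exists_block_code _ hν pS hpS W hW (fun ω m => xE ω.2.2.2 m)
    (fun ω s l => kE ω.2.1 (gE ω.1 s l, s))
    (fun ω s l y => (hE ω.2.2.1 (y, gE ω.1 s l, s)).2) (fun ω y => (gD ω.1 y).2)
    (fun ω y l => xD ω.2.2.2 ((gD ω.1 y).1, hD ω.2.2.1 ((gD ω.1 y).1, y) l, y))
    hb ⟨0, hL⟩ ⟨0, hM⟩ B

/-- Concatenation of blocks. -/
def flattenEquiv (b n : ℕ) (A : Type) : (Fin b → Fin n → A) ≃ (Fin (b * n) → A) where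
  toFun z k := z (finProdFinEquiv.symm k).1 (finProdFinEquiv.symm k).2
  invFun y i j := y (finProdFinEquiv (i, j))
  left_inv z := by ext i j; simp
  right_inv y := by ext k; simp [-finProdFinEquiv_symm_apply]

/-- Concatenation of blocks of pairs. -/
def flattenPairEquiv (b n : ℕ) (A A' : Type) :
    (Fin b → (Fin n → A) × (Fin n → A')) ≃ (Fin (b * n) → A × A') where
  toFun z k := ((z (finProdFinEquiv.symm k).1).1 (finProdFinEquiv.symm k).2,
    (z (finProdFinEquiv.symm k).1).2 (finProdFinEquiv.symm k).2)
  invFun y i := (fun j => (y (finProdFinEquiv (i, j))).1, fun j => (y (finProdFinEquiv (i, j))).2)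
  left_inv z := by ext i j <;> simp
  right_inv y := by ext k <;> simp [-finProdFinEquiv_symm_apply]

lemma prod_flatten {b n : ℕ} (f : Fin (b * n) → ℝ) :
    ∏ k, f k = ∏ i : Fin b, ∏ j : Fin n, f (finProdFinEquiv (i, j)) := by
  rw [← finProdFinEquiv.prod_comp, Fintype.prod_prod_type]

/-- Memoryless extension of a state-dependent relay channel. -/
def channelPow {X1 X2 Y2 Y3 S : Type} (W : X1 → X2 → S → Y2 × Y3 → ℝ) (n : ℕ)
    (x1 : Fin n → X1) (x2 : Fin n → X2) (s : Fin n → S) (y : (Fin n → Y2) × (Fin n → Y3)) : ℝ :=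
  ∏ i, W (x1 i) (x2 i) (s i) (y.1 i, y.2 i)

/-- A block code whose letters are themselves blocks yields a code for the relay channel. -/
theorem exists_flattened_code {X1 X2 Y2 Y3 S : Type} [Fintype X1] [Fintype X2] [Fintype Y2]
    [Fintype Y3] [Fintype S] (pS : S → ℝ) (W : X1 → X2 → S → Y2 × Y3 → ℝ) {n b B M : ℕ} {ε : ℝ}
    (enc1 : (Fin B → Fin M) → Fin b → Fin n → X1)
    (enc2 : (Fin b → Fin n → S) → (Fin b → Fin n → Y2) → Fin b → Fin n → X2)
    (dec : (Fin b → Fin n → Y3) → Fin B → Fin M)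
    (hc : ∀ s y y' i, (∀ j, j < i → y j = y' j) → enc2 s y i = enc2 s y' i)
    (hε : ∑ w, ∑ s : Fin b → Fin n → S, ∑ y : Fin b → (Fin n → Y2) × (Fin n → Y3),
        (if dec (fun j => (y j).2) = w then 0
        else (Fintype.card (Fin B → Fin M) : ℝ)⁻¹ * (∏ j, ∏ i, pS (s j i)) *
          ∏ j, channelPow W n (enc1 w j) (enc2 s (fun i => (y i).1) j) (s j) (y j)) ≤ ε) :
    ∃ (enc1 : Fin (M ^ B) → Fin (b * n) → X1)
      (enc2 : (Fin (b * n) → S) → (Fin (b * n) → Y2) → Fin (b * n) → X2)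
      (dec2 : (Fin (b * n) → Y3) → Fin (M ^ B)),
      (∀ s y y' j, (∀ i, i < j → y i = y' i) → enc2 s y j = enc2 s y' j) ∧
      errProbRCrel pS W enc1 enc2 dec2 ≤ ε := by
  refine ⟨fun w => flattenEquiv b n X1 (enc1 (finFunctionFinEquiv.symm w)),
    fun s y => flattenEquiv b n X2 (enc2 ((flattenEquiv b n S).symm s)
      ((flattenEquiv b n Y2).symm y)),
    fun y => finFunctionFinEquiv (dec ((flattenEquiv b n Y3).symm y)), ?_, ?_⟩
  · intro s y y' j h
    simp only [flattenEquiv, Equiv.coe_fn_mk, Equiv.coe_fn_symm_mk]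
    rw [hc]
    intro i hi
    ext k
    refine h _ ?_
    have h1 := finProdFinEquiv.apply_symm_apply j
    rw [Fin.lt_def] at hi ⊢
    rw [← h1]
    simp only [finProdFinEquiv_apply_val]
    have h2 := k.2
    set a : ℕ := ((finProdFinEquiv.symm j).1 : ℕ)
    have : n * ((i : ℕ) + 1) ≤ n * a := Nat.mul_le_mul_left _ hi
    have e : n * ((i : ℕ) + 1) = n * i + n := by ring
    omega
  · refine le_trans (le_of_eq ?_) hε
    unfold errProbRCrel
    rw [← finFunctionFinEquiv.sum_comp]
    refine Finset.sum_congr rfl fun w _ => ?_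
    rw [← (flattenEquiv b n S).sum_comp]
    refine Finset.sum_congr rfl fun s _ => ?_
    rw [← (flattenPairEquiv b n Y2 Y3).sum_comp]
    refine Finset.sum_congr rfl fun y _ => ?_
    have e3 : (flattenEquiv b n Y3).symm (fun j => (flattenPairEquiv b n Y2 Y3 y j).2)
        = fun j => (y j).2 := by
      ext i j; simp [-finProdFinEquiv_symm_apply, flattenEquiv, flattenPairEquiv]
    have e2 : (flattenEquiv b n Y2).symm (fun j => (flattenPairEquiv b n Y2 Y3 y j).1)
        = fun j => (y j).1 := by
      ext i j; simp [-finProdFinEquiv_symm_apply, flattenEquiv, flattenPairEquiv]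
    simp only [e3, e2, Equiv.symm_apply_apply, EmbeddingLike.apply_eq_iff_eq]
    refine if_congr Iff.rfl rfl ?_
    rw [prod_flatten, prod_flatten]
    simp [-finProdFinEquiv_symm_apply, flattenEquiv, flattenPairEquiv, channelPow]

lemma exists_rpow_moment_lt_one {A : Type} [Fintype A] {m a : A → ℝ} (hm : ∑ x, m x = 1)
    (ha : ∀ x, m x ≠ 0 → 0 < a x) (h : ∑ x, m x * Real.log (a x) < 0) :
    ∃ lam : ℝ, 0 ≤ lam ∧ lam ≤ 1 ∧ ∑ x, m x * a x ^ lam < 1 := by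
  have hd : HasDerivAt (fun t : ℝ => ∑ x, m x * Real.exp (t * Real.log (a x)))
      (∑ x, m x * Real.log (a x)) 0 := by
    refine HasDerivAt.fun_sum fun x _ => HasDerivAt.const_mul _ ?_
    simpa using ((hasDerivAt_id (0 : ℝ)).mul_const (Real.log (a x))).exp
  have he := hd.tendsto_slope_zero_right.eventually (gt_mem_nhds h)
  obtain ⟨t, ht, h0, h1⟩ :=
    (he.and (Ioc_mem_nhdsGT (show (0 : ℝ) < 1 from one_pos))).exists
  refine ⟨t, h0.le, h1, ?_⟩
  have hlt := neg_of_mul_neg_right ht (inv_pos.2 h0).le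
  simp only [zero_add, zero_mul, Real.exp_zero, mul_one, hm] at hlt
  refine lt_of_eq_of_lt (Finset.sum_congr rfl fun x _ => ?_) (sub_neg.1 hlt)
  by_cases hx : m x = 0
  · simp [hx]
  · rw [Real.rpow_def_of_pos (ha x hx), mul_comm t]

lemma sum_prod_mul_mismatch_le {A : Type} [Fintype A] {n : ℕ} {j a : A → ℝ} {lam κ : ℝ}
    {P Q : (Fin n → A) → ℝ} (hj : ∀ x, 0 ≤ j x) (ha : ∀ x, j x ≠ 0 → 0 ≤ a x)
    (hP : ∀ z, 0 ≤ P z) (hQ : ∀ z, (∀ i, j (z i) ≠ 0) → 0 < Q z)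
    (hPQ : ∀ z, (∀ i, j (z i) ≠ 0) → P z / Q z ≤ 2 * ∏ i, (Real.exp κ * a (z i)))
    (h0 : 0 ≤ lam) (h1 : lam ≤ 1) :
    ∑ z, (∏ i, j (z i)) * mismatch lam (P z) (Q z)
      ≤ 2 * (∑ x, j x * (Real.exp κ * a x) ^ lam) ^ n := by
  rw [Fintype.sum_pow, Finset.mul_sum]
  refine Finset.sum_le_sum fun z _ => ?_
  by_cases hz : ∀ i, j (z i) ≠ 0
  · have hpos : ∀ i, 0 ≤ Real.exp κ * a (z i) := fun i =>
      mul_nonneg (Real.exp_pos _).le (ha _ (hz i))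
    have hmm : mismatch lam (P z) (Q z) ≤ (P z / Q z) ^ lam := by
      unfold mismatch
      rw [if_neg (hQ z hz).ne']
      have := Real.rpow_nonneg (div_nonneg (hP z) (hQ z hz).le) lam
      split_ifs <;> simp [this]
    have h2 : (P z / Q z) ^ lam ≤ 2 * ∏ i, (Real.exp κ * a (z i)) ^ lam := by
      calc (P z / Q z) ^ lam ≤ (2 * ∏ i, (Real.exp κ * a (z i))) ^ lam :=
            Real.rpow_le_rpow (div_nonneg (hP z) (hQ z hz).le) (hPQ z hz) h0
        _ = 2 ^ lam * ∏ i, (Real.exp κ * a (z i)) ^ lam := by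
            rw [Real.mul_rpow two_pos.le (Finset.prod_nonneg fun i _ => hpos i),
              Real.finsetProd_rpow _ _ fun i _ => hpos i]
        _ ≤ 2 * ∏ i, (Real.exp κ * a (z i)) ^ lam := by
            refine mul_le_mul_of_nonneg_right ?_
              (Finset.prod_nonneg fun i _ => Real.rpow_nonneg (hpos i) _)
            calc (2 : ℝ) ^ lam ≤ 2 ^ (1 : ℝ) := Real.rpow_le_rpow_of_exponent_le one_le_two h1
              _ = 2 := Real.rpow_one 2
    rw [Finset.prod_mul_distrib]
    calc _ ≤ (∏ i, j (z i)) * (2 * ∏ i, (Real.exp κ * a (z i)) ^ lam) :=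
          mul_le_mul_of_nonneg_left (hmm.trans h2) (Finset.prod_nonneg fun i _ => hj _)
      _ = _ := by ring
  · push Not at hz
    obtain ⟨i, hi⟩ := hz
    have h3 : ∏ i, j (z i) = 0 := Finset.prod_eq_zero (mem_univ i) hi
    rw [Finset.prod_mul_distrib, h3, zero_mul, zero_mul, mul_zero]

lemma isPmf_channelPow {X1 X2 Y2 Y3 S : Type} [Fintype Y2] [Fintype Y3]
    {W : X1 → X2 → S → Y2 × Y3 → ℝ} (hW : ∀ x1 x2 s, IsPmf (W x1 x2 s)) (n : ℕ)
    (x1 : Fin n → X1) (x2 : Fin n → X2) (s : Fin n → S) : IsPmf (channelPow W n x1 x2 s) := by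
  have h := IsPmf.pi fun i => hW (x1 i) (x2 i) (s i)
  refine ⟨fun y => h.1 fun i => (y.1 i, y.2 i), ?_⟩
  rw [← h.2, ← (Equiv.arrowProdEquivProdArrow (Fin n) (fun _ => Y2) (fun _ => Y3)).sum_comp]
  rfl

/-- Joint pmf of the relay channel with auxiliary variables when the law of the source letter is
chosen by a time-sharing variable. -/
def timeSharedPmf {T S Q X1 X2 Y2 Y3 H : Type} (pT : T → ℝ) (pS : S → ℝ) (pQ : S → Q → ℝ)
    (pX2 : Q × S → X2 → ℝ) (pX1 : T → X1 → ℝ) (W : X1 → X2 → S → Y2 × Y3 → ℝ)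
    (pH : Y2 × Q × S → H → ℝ) (z : T × ΩRCrel S Q X1 X2 Y2 Y3 H) : ℝ :=
  pT z.1 * relayPmf pS pQ pX2 (pX1 z.1) W pH z.2

/-- Sequences of letters of the relay channel as letters of sequences. -/
def relaySeqEquiv (n : ℕ) (T S Q X1 X2 Y2 Y3 H : Type) :
    (Fin n → T × ΩRCrel S Q X1 X2 Y2 Y3 H) ≃ (Fin n → T) ×
      ΩRCrel (Fin n → S) (Fin n → Q) (Fin n → X1) (Fin n → X2) (Fin n → Y2) (Fin n → Y3)
        (Fin n → H) where
  toFun z := (fun i => (z i).1, fun i => vS (z i).2, fun i => vQ2 (z i).2, fun i => vX1 (z i).2,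
    fun i => vX2 (z i).2, fun i => vY2 (z i).2, fun i => vY3 (z i).2, fun i => vYH (z i).2)
  invFun z i := (z.1 i, vS z.2 i, vQ2 z.2 i, vX1 z.2 i, vX2 z.2 i, vY2 z.2 i, vY3 z.2 i, vYH z.2 i)
  left_inv _ := rfl
  right_inv _ := rfl

/-- Compress–forward codes built from memoryless couplings. -/
theorem exists_compressForward_memoryless {T S Q X1 X2 Y2 Y3 H : Type} [Fintype T] [Fintype S]
    [Fintype Q] [Fintype X1] [Fintype X2] [Fintype Y2] [Fintype Y3] [Fintype H]
    (pT : T → ℝ) (hpT : IsPmf pT)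
    (pS : S → ℝ) (hpS : IsPmf pS) (pQ : S → Q → ℝ) (hpQ : IsKernel pQ)
    (pX2 : Q × S → X2 → ℝ) (hpX2 : IsKernel pX2) (pX1 : T → X1 → ℝ) (hpX1 : IsKernel pX1)
    (W : X1 → X2 → S → Y2 × Y3 → ℝ) (hW : ∀ x1 x2 s, IsPmf (W x1 x2 s))
    (pH : Y2 × Q × S → H → ℝ) (hpH : IsKernel pH)
    (rG : T × Y3 → Q → ℝ) (hrG : IsKernel rG) (rH : T × Q × Y3 → H → ℝ) (hrH : IsKernel rH)
    (rX : T × Q × H × Y3 → X1 → ℝ) (hrX : IsKernel rX) {L M : ℕ} (hL : 0 < L) (hM : 0 < M)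
    {lamG lamH lamX : ℝ} (hG0 : 0 ≤ lamG) (hG1 : lamG ≤ 1) (hH0 : 0 ≤ lamH) (hH1 : lamH ≤ 1)
    (hX0 : 0 ≤ lamX) (hX1 : lamX ≤ 1) (B n : ℕ) {εG εH εX : ℝ}
    (hεG : ∑ z : Fin n → T × ΩRCrel S Q X1 X2 Y2 Y3 H,
      (∏ i, timeSharedPmf pT pS pQ pX2 pX1 W pH (z i)) *
        mismatch lamG (∏ i, pQ (vS (z i).2) (vQ2 (z i).2))
          ((∏ i, rG ((z i).1, vY3 (z i).2) (vQ2 (z i).2)) / L) ≤ εG)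
    (hεH : ∑ z : Fin n → T × ΩRCrel S Q X1 X2 Y2 Y3 H,
      (∏ i, timeSharedPmf pT pS pQ pX2 pX1 W pH (z i)) *
        mismatch lamH ((∏ i, pH (vY2 (z i).2, vQ2 (z i).2, vS (z i).2) (vYH (z i).2)) / L)
          (∏ i, rH ((z i).1, vQ2 (z i).2, vY3 (z i).2) (vYH (z i).2)) ≤ εH)
    (hεX : ∑ z : Fin n → T × ΩRCrel S Q X1 X2 Y2 Y3 H,
      (∏ i, timeSharedPmf pT pS pQ pX2 pX1 W pH (z i)) *
        mismatch lamX (∏ i, pX1 (z i).1 (vX1 (z i).2))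
          ((∏ i, rX ((z i).1, vQ2 (z i).2, vYH (z i).2, vY3 (z i).2) (vX1 (z i).2)) / M) ≤ εX) :
    ∃ (enc1 : Fin (M ^ B) → Fin ((B + 1) * n) → X1)
      (enc2 : (Fin ((B + 1) * n) → S) → (Fin ((B + 1) * n) → Y2) → Fin ((B + 1) * n) → X2)
      (dec2 : (Fin ((B + 1) * n) → Y3) → Fin (M ^ B)),
      (∀ s y y' j, (∀ i, i < j → y i = y' i) → enc2 s y j = enc2 s y' j) ∧
      errProbRCrel pS W enc1 enc2 dec2 ≤ (B + 1) * (εG + εH + εX) := by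
  have avg : ∑ t : Fin n → T, (∏ i, pT (t i)) *
      ∑ ω : ΩRCrel (Fin n → S) (Fin n → Q) (Fin n → X1) (Fin n → X2) (Fin n → Y2) (Fin n → Y3)
        (Fin n → H), relayPmf (fun s => ∏ i, pS (s i)) (fun s q => ∏ i, pQ (s i) (q i))
          (fun (a : (Fin n → Q) × (Fin n → S)) x => ∏ i, pX2 (a.1 i, a.2 i) (x i))
          (fun x => ∏ i, pX1 (t i) (x i))
          (channelPow W n) (fun (a : (Fin n → Y2) × (Fin n → Q) × (Fin n → S)) h =>
            ∏ i, pH (a.1 i, a.2.1 i, a.2.2 i) (h i)) ω *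
        (mismatch lamG (∏ i, pQ (vS ω i) (vQ2 ω i)) ((∏ i, rG (t i, vY3 ω i) (vQ2 ω i)) / L)
          + mismatch lamH ((∏ i, pH (vY2 ω i, vQ2 ω i, vS ω i) (vYH ω i)) / L)
            (∏ i, rH (t i, vQ2 ω i, vY3 ω i) (vYH ω i))
          + mismatch lamX (∏ i, pX1 (t i) (vX1 ω i))
            ((∏ i, rX (t i, vQ2 ω i, vYH ω i, vY3 ω i) (vX1 ω i)) / M)) ≤ εG + εH + εX := by
    refine le_trans (le_of_eq ?_) (add_le_add (add_le_add hεG hεH) hεX)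
    simp only [Finset.mul_sum]
    rw [← Fintype.sum_prod_type', ← (relaySeqEquiv n T S Q X1 X2 Y2 Y3 H).sum_comp,
      ← Finset.sum_add_distrib, ← Finset.sum_add_distrib]
    refine Finset.sum_congr rfl fun z _ => ?_
    simp only [timeSharedPmf, relayPmf, Finset.prod_mul_distrib, channelPow]
    rw [← mul_add, ← mul_add, ← mul_assoc]
    rfl
  obtain ⟨t, ht⟩ := exists_le_of_pmf_average (IsPmf.pi fun _ => hpT) avg
  obtain ⟨enc1, enc2, dec, hc, he⟩ := exists_compressForward_code
    (fun s : Fin n → S => ∏ i, pS (s i)) (IsPmf.pi fun _ => hpS)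
    (fun s (q : Fin n → Q) => ∏ i, pQ (s i) (q i)) (fun s => IsPmf.pi fun i => hpQ (s i))
    (fun a (x : Fin n → X2) => ∏ i, pX2 (a.1 i, a.2 i) (x i))
    (fun a => IsPmf.pi fun i => hpX2 (a.1 i, a.2 i))
    (fun x : Fin n → X1 => ∏ i, pX1 (t i) (x i)) (IsPmf.pi fun i => hpX1 (t i))
    (channelPow W n) (isPmf_channelPow hW n)
    (fun a (h : Fin n → H) => ∏ i, pH (a.1 i, a.2.1 i, a.2.2 i) (h i))
    (fun a => IsPmf.pi fun i => hpH (a.1 i, a.2.1 i, a.2.2 i))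
    (fun y q => ∏ i, rG (t i, y i) (q i)) (fun y => IsPmf.pi fun i => hrG (t i, y i))
    (fun a h => ∏ i, rH (t i, a.1 i, a.2 i) (h i))
    (fun a => IsPmf.pi fun i => hrH (t i, a.1 i, a.2 i))
    (fun a x => ∏ i, rX (t i, a.1 i, a.2.1 i, a.2.2 i) (x i))
    (fun a => IsPmf.pi fun i => hrX (t i, a.1 i, a.2.1 i, a.2.2 i))
    hL hM hG0 hG1 hH0 hH1 hX0 hX1 B
  refine exists_flattened_code pS W enc1 enc2 dec hc (he.trans ?_)
  exact mul_le_mul_of_nonneg_left ht (by positivity)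

lemma sum_log_exp_mul {A : Type} [Fintype A] {w a : A → ℝ} (hw : ∑ x, w x = 1)
    (ha : ∀ x, w x ≠ 0 → 0 < a x) (κ : ℝ) :
    ∑ x, w x * Real.log (Real.exp κ * a x) = κ + ∑ x, w x * Real.log (a x) := by
  have e : ∀ x, w x * Real.log (Real.exp κ * a x) = w x * κ + w x * Real.log (a x) := by
    intro x
    by_cases hx : w x = 0
    · simp [hx]
    · rw [Real.log_mul (Real.exp_pos _).ne' (ha x hx).ne', Real.log_exp]; ring
  simp only [e, Finset.sum_add_distrib, ← Finset.sum_mul, hw, one_mul]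

lemma exists_exp_moment_lt_one {A : Type} [Fintype A] {w a : A → ℝ} (hw : IsPmf w)
    (ha : ∀ x, w x ≠ 0 → 0 < a x) {κ : ℝ} (h : ∑ x, w x * Real.log (a x) < -κ) :
    ∃ lam θ : ℝ, 0 ≤ lam ∧ lam ≤ 1 ∧ 0 ≤ θ ∧ θ < 1 ∧
      ∑ x, w x * (Real.exp κ * a x) ^ lam = θ := by
  obtain ⟨lam, h0, h1, h2⟩ := exists_rpow_moment_lt_one (a := fun x => Real.exp κ * a x) hw.2
    (fun x hx => mul_pos (Real.exp_pos κ) (ha x hx))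
    (by rw [sum_log_exp_mul hw.2 ha]; linarith)
  refine ⟨lam, _, h0, h1, Finset.sum_nonneg fun x _ => ?_, h2, rfl⟩
  by_cases hx : w x = 0
  · simp [hx]
  · exact mul_nonneg (hw.1 x) (Real.rpow_nonneg (mul_pos (Real.exp_pos κ) (ha x hx)).le _)

lemma prod_exp_mul {n : ℕ} (κ : ℝ) (a : Fin n → ℝ) :
    ∏ i, (Real.exp κ * a i) = Real.exp (n * κ) * ∏ i, a i := by
  rw [Finset.prod_mul_distrib, Finset.prod_const, Finset.card_univ, Fintype.card_fin,
    Real.exp_nat_mul]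

/-- Exponential decay of the mismatch when an index of rate `κ` is attached to the reference
weight. -/
lemma exists_indexed_exponent {A : Type} [Fintype A] {w p r : A → ℝ} (hw : IsPmf w)
    (hp : ∀ x, 0 ≤ p x) (hp' : ∀ x, w x ≠ 0 → 0 < p x) (hr : ∀ x, w x ≠ 0 → 0 < r x) {κ : ℝ}
    (h : ∑ x, w x * Real.log (p x / r x) < -κ) :
    ∃ lam θ : ℝ, 0 ≤ lam ∧ lam ≤ 1 ∧ 0 ≤ θ ∧ θ < 1 ∧ ∀ (n L : ℕ), 0 < L →
      (L : ℝ) ≤ 2 * Real.exp (n * κ) →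
      ∑ z : Fin n → A, (∏ i, w (z i)) * mismatch lam (∏ i, p (z i)) ((∏ i, r (z i)) / L)
        ≤ 2 * θ ^ n := by
  obtain ⟨lam, θ, h0, h1, h2, h3, rfl⟩ :=
    exists_exp_moment_lt_one hw (fun x hx => div_pos (hp' x hx) (hr x hx)) h
  refine ⟨lam, _, h0, h1, h2, h3, fun n L hL hLe => ?_⟩
  refine sum_prod_mul_mismatch_le hw.1 (fun x hx => (div_pos (hp' x hx) (hr x hx)).le)
    (fun z => Finset.prod_nonneg fun i _ => hp _)
    (fun z hz => div_pos (Finset.prod_pos fun i _ => hr _ (hz i)) (by exact_mod_cast hL))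
    (fun z hz => ?_) h0 h1
  rw [prod_exp_mul, Finset.prod_div_distrib, div_div_eq_mul_div, mul_comm _ (L : ℝ), mul_div_assoc,
    ← mul_assoc]
  exact mul_le_mul_of_nonneg_right hLe (div_nonneg (Finset.prod_nonneg fun i _ => hp _)
    (Finset.prod_nonneg fun i _ => (hr _ (hz i)).le))

/-- Exponential decay of the mismatch when an index of rate `κ` is attached to the target
weight. -/
lemma exists_binning_exponent {A : Type} [Fintype A] {w p r : A → ℝ} (hw : IsPmf w)
    (hp : ∀ x, 0 ≤ p x) (hp' : ∀ x, w x ≠ 0 → 0 < p x) (hr : ∀ x, w x ≠ 0 → 0 < r x) {κ : ℝ}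
    (h : ∑ x, w x * Real.log (p x / r x) < κ) :
    ∃ lam θ : ℝ, 0 ≤ lam ∧ lam ≤ 1 ∧ 0 ≤ θ ∧ θ < 1 ∧ ∀ (n L : ℕ), 0 < L →
      Real.exp (n * κ) ≤ L →
      ∑ z : Fin n → A, (∏ i, w (z i)) * mismatch lam ((∏ i, p (z i)) / L) (∏ i, r (z i))
        ≤ 2 * θ ^ n := by
  rw [← neg_neg κ] at h
  obtain ⟨lam, θ, h0, h1, h2, h3, rfl⟩ :=
    exists_exp_moment_lt_one hw (fun x hx => div_pos (hp' x hx) (hr x hx)) h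
  refine ⟨lam, _, h0, h1, h2, h3, fun n L hL hLe => ?_⟩
  refine sum_prod_mul_mismatch_le hw.1 (fun x hx => (div_pos (hp' x hx) (hr x hx)).le)
    (fun z => div_nonneg (Finset.prod_nonneg fun i _ => hp _) (Nat.cast_nonneg _))
    (fun z hz => Finset.prod_pos fun i _ => hr _ (hz i))
    (fun z hz => ?_) h0 h1
  have hq : 0 ≤ ∏ i, p (z i) / r (z i) :=
    Finset.prod_nonneg fun i _ => div_nonneg (hp _) (hr _ (hz i)).le
  rw [prod_exp_mul, div_right_comm, ← Finset.prod_div_distrib, mul_neg, Real.exp_neg]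
  have h4 : (L : ℝ)⁻¹ ≤ (Real.exp (n * κ))⁻¹ := inv_anti₀ (Real.exp_pos _) hLe
  rw [div_eq_mul_inv, mul_comm]
  have h5 := mul_le_mul_of_nonneg_right h4 hq
  have h6 : 0 ≤ (Real.exp (n * κ))⁻¹ * ∏ i, p (z i) / r (z i) :=
    mul_nonneg (inv_nonneg.2 (Real.exp_pos _).le) hq
  linarith

lemma exists_nat_exp_le {κ : ℝ} (hκ : 0 ≤ κ) :
    ∃ L : ℕ, 0 < L ∧ Real.exp κ ≤ L ∧ (L : ℝ) ≤ 2 * Real.exp κ := by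
  refine ⟨⌈Real.exp κ⌉₊, Nat.ceil_pos.2 (Real.exp_pos _), Nat.le_ceil _, ?_⟩
  have h1 := Nat.ceil_lt_add_one (Real.exp_pos κ).le
  have h2 := Real.one_le_exp hκ
  linarith

lemma isPmf_timeSharedPmf {T S Q X1 X2 Y2 Y3 H : Type} [Fintype T] [Fintype S]
    [Fintype Q] [Fintype X1] [Fintype X2] [Fintype Y2] [Fintype Y3] [Fintype H]
    {pT : T → ℝ} (hpT : IsPmf pT)
    {pS : S → ℝ} (hpS : IsPmf pS) {pQ : S → Q → ℝ} (hpQ : IsKernel pQ)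
    {pX2 : Q × S → X2 → ℝ} (hpX2 : IsKernel pX2) {pX1 : T → X1 → ℝ} (hpX1 : IsKernel pX1)
    {W : X1 → X2 → S → Y2 × Y3 → ℝ} (hW : ∀ x1 x2 s, IsPmf (W x1 x2 s))
    {pH : Y2 × Q × S → H → ℝ} (hpH : IsKernel pH) :
    IsPmf (timeSharedPmf pT pS pQ pX2 pX1 W pH) := by
  refine ⟨fun z => mul_nonneg (hpT.1 _) (mul_nonneg (mul_nonneg (mul_nonneg (mul_nonneg
    (mul_nonneg (hpS.1 _) ((hpQ _).1 _)) ((hpX2 _).1 _)) ((hpX1 _).1 _)) ((hW _ _ _).1 _))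
    ((hpH _).1 _)), ?_⟩
  have e : ∀ z, timeSharedPmf pT pS pQ pX2 pX1 W pH z = pT z.1 * (pS (vS z.2) *
      (pQ (vS z.2) (vQ2 z.2) * (pX1 z.1 (vX1 z.2) * (pX2 (vQ2 z.2, vS z.2) (vX2 z.2) *
      (W (vX1 z.2) (vX2 z.2) (vS z.2) (vY2 z.2, vY3 z.2) *
        pH (vY2 z.2, vQ2 z.2, vS z.2) (vYH z.2)))))) := fun z => by
    simp only [timeSharedPmf, relayPmf]; ring
  have hW' : ∀ x1 x2 s, ∑ y2, ∑ y3, W x1 x2 s (y2, y3) = 1 := fun x1 x2 s => by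
    rw [← Fintype.sum_prod_type', (hW x1 x2 s).2]
  simp only [e, Fintype.sum_prod_type, vS, vQ2, vX1, vX2, vY2, vY3, vYH, ← Finset.mul_sum,
    (hpH _).2, mul_one, hW', (hpX2 _).2, (hpX1 _).2, (hpQ _).2, hpS.2, hpT.2]

/-- Gibbs' inequality for the conditional law of the compressed observation. -/
lemma sum_timeSharedPmf_mul_log_nonneg {T S Q X1 X2 Y2 Y3 H : Type} [Fintype T] [Fintype S]
    [Fintype Q] [Fintype X1] [Fintype X2] [Fintype Y2] [Fintype Y3] [Fintype H]
    {pT : T → ℝ} (hpT : IsPmf pT)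
    {pS : S → ℝ} (hpS : IsPmf pS) {pQ : S → Q → ℝ} (hpQ : IsKernel pQ)
    {pX2 : Q × S → X2 → ℝ} (hpX2 : IsKernel pX2) {pX1 : T → X1 → ℝ} (hpX1 : IsKernel pX1)
    {W : X1 → X2 → S → Y2 × Y3 → ℝ} (hW : ∀ x1 x2 s, IsPmf (W x1 x2 s))
    {pH : Y2 × Q × S → H → ℝ} (hpH : IsKernel pH) {rH : T × Q × Y3 → H → ℝ} (hrH : IsKernel rH)
    (hr : ∀ z, timeSharedPmf pT pS pQ pX2 pX1 W pH z ≠ 0 →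
      0 < rH (z.1, vQ2 z.2, vY3 z.2) (vYH z.2)) :
    0 ≤ ∑ z, timeSharedPmf pT pS pQ pX2 pX1 W pH z *
      Real.log (pH (vY2 z.2, vQ2 z.2, vS z.2) (vYH z.2) /
        rH (z.1, vQ2 z.2, vY3 z.2) (vYH z.2)) := by
  set w : T × ΩRCrel S Q X1 X2 Y2 Y3 H → ℝ := fun z => pT z.1 * (pS (vS z.2) *
    pQ (vS z.2) (vQ2 z.2) * pX2 (vQ2 z.2, vS z.2) (vX2 z.2) * pX1 z.1 (vX1 z.2) *
      W (vX1 z.2) (vX2 z.2) (vS z.2) (vY2 z.2, vY3 z.2)) with hwdef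
  have hw0 : ∀ z, 0 ≤ w z := fun z => mul_nonneg (hpT.1 _) (mul_nonneg (mul_nonneg (mul_nonneg
    (mul_nonneg (hpS.1 _) ((hpQ _).1 _)) ((hpX2 _).1 _)) ((hpX1 _).1 _)) ((hW _ _ _).1 _))
  have hw : ∀ z, timeSharedPmf pT pS pQ pX2 pX1 W pH z
      = w z * pH (vY2 z.2, vQ2 z.2, vS z.2) (vYH z.2) := fun z => by
    simp only [timeSharedPmf, relayPmf, hwdef]; ring
  have hz : ∑ z, w z * (pH (vY2 z.2, vQ2 z.2, vS z.2) (vYH z.2)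
      - rH (z.1, vQ2 z.2, vY3 z.2) (vYH z.2)) = 0 := by
    simp only [Fintype.sum_prod_type, hwdef, vS, vQ2, vX1, vX2, vY2, vY3, vYH, ← Finset.mul_sum,
      Finset.sum_sub_distrib, (hpH _).2, (hrH _).2, sub_self, mul_zero, Finset.sum_const_zero]
  rw [← hz]
  refine Finset.sum_le_sum fun z _ => ?_
  have hp0 := (hpH (vY2 z.2, vQ2 z.2, vS z.2)).1 (vYH z.2)
  have hr0 := (hrH (z.1, vQ2 z.2, vY3 z.2)).1 (vYH z.2)
  have hrz := hr z
  rw [hw z] at hrz ⊢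
  generalize pH (vY2 z.2, vQ2 z.2, vS z.2) (vYH z.2) = p at *
  generalize rH (z.1, vQ2 z.2, vY3 z.2) (vYH z.2) = r at *
  by_cases h : w z * p = 0
  · rw [h, zero_mul, mul_sub, h, zero_sub]
    exact neg_nonpos.2 (mul_nonneg (hw0 z) hr0)
  · have hr1 := hrz h
    have hp1 : 0 < p := lt_of_le_of_ne hp0 fun h' => h (by rw [← h', mul_zero])
    have hl := Real.one_sub_inv_le_log_of_pos (div_pos hp1 hr1)
    calc w z * (p - r) = w z * p * (1 - (p / r)⁻¹) := by field_simp
      _ ≤ _ := mul_le_mul_of_nonneg_left hl (mul_nonneg (hw0 z) hp0)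

/-- Compress–forward achievability in terms of log-likelihood ratios between the sampling kernels
and the reference kernels used by the destination. -/
theorem achievable_of_logRatio {T S Q X1 X2 Y2 Y3 H : Type} [Fintype T] [Fintype S]
    [Fintype Q] [Fintype X1] [Fintype X2] [Fintype Y2] [Fintype Y3] [Fintype H]
    (pT : T → ℝ) (hpT : IsPmf pT)
    (pS : S → ℝ) (hpS : IsPmf pS) (pQ : S → Q → ℝ) (hpQ : IsKernel pQ)
    (pX2 : Q × S → X2 → ℝ) (hpX2 : IsKernel pX2) (pX1 : T → X1 → ℝ) (hpX1 : IsKernel pX1)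
    (W : X1 → X2 → S → Y2 × Y3 → ℝ) (hW : ∀ x1 x2 s, IsPmf (W x1 x2 s))
    (pH : Y2 × Q × S → H → ℝ) (hpH : IsKernel pH)
    (rG : T × Y3 → Q → ℝ) (hrG : IsKernel rG) (rH : T × Q × Y3 → H → ℝ) (hrH : IsKernel rH)
    (rX : T × Q × H × Y3 → X1 → ℝ) (hrX : IsKernel rX)
    (hG : ∀ z, timeSharedPmf pT pS pQ pX2 pX1 W pH z ≠ 0 → 0 < rG (z.1, vY3 z.2) (vQ2 z.2))
    (hH : ∀ z, timeSharedPmf pT pS pQ pX2 pX1 W pH z ≠ 0 →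
      0 < rH (z.1, vQ2 z.2, vY3 z.2) (vYH z.2))
    (hX : ∀ z, timeSharedPmf pT pS pQ pX2 pX1 W pH z ≠ 0 →
      0 < rX (z.1, vQ2 z.2, vYH z.2, vY3 z.2) (vX1 z.2))
    (hrelay : ((∀ a q, rG a q = 1) ∧ ∀ a h, rH a h = 1) ∨
      ∑ z, timeSharedPmf pT pS pQ pX2 pX1 W pH z *
        Real.log (pQ (vS z.2) (vQ2 z.2) / rG (z.1, vY3 z.2) (vQ2 z.2))
      + ∑ z, timeSharedPmf pT pS pQ pX2 pX1 W pH z *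
        Real.log (pH (vY2 z.2, vQ2 z.2, vS z.2) (vYH z.2) /
          rH (z.1, vQ2 z.2, vY3 z.2) (vYH z.2)) < 0)
    {R : ℝ} (hR : 0 ≤ R)
    (hsource : ∑ z, timeSharedPmf pT pS pQ pX2 pX1 W pH z *
      Real.log (pX1 z.1 (vX1 z.2) / rX (z.1, vQ2 z.2, vYH z.2, vY3 z.2) (vX1 z.2))
        < -(R * Real.log 2)) :
    AchievableRCrel pS W R := by
  have hw := isPmf_timeSharedPmf hpT hpS hpQ hpX2 hpX1 hW hpH
  have hgibbs := sum_timeSharedPmf_mul_log_nonneg hpT hpS hpQ hpX2 hpX1 hW hpH hrH hH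
  have posQ : ∀ z, timeSharedPmf pT pS pQ pX2 pX1 W pH z ≠ 0 → 0 < pQ (vS z.2) (vQ2 z.2) :=
    fun z hz => lt_of_le_of_ne ((hpQ _).1 _) fun h => hz (by simp [timeSharedPmf, relayPmf, ← h])
  have posH : ∀ z, timeSharedPmf pT pS pQ pX2 pX1 W pH z ≠ 0 →
      0 < pH (vY2 z.2, vQ2 z.2, vS z.2) (vYH z.2) :=
    fun z hz => lt_of_le_of_ne ((hpH _).1 _) fun h => hz (by simp [timeSharedPmf, relayPmf, ← h])
  have posX : ∀ z, timeSharedPmf pT pS pQ pX2 pX1 W pH z ≠ 0 → 0 < pX1 z.1 (vX1 z.2) :=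
    fun z hz => lt_of_le_of_ne ((hpX1 _).1 _) fun h => hz (by simp [timeSharedPmf, relayPmf, ← h])
  set w := timeSharedPmf pT pS pQ pX2 pX1 W pH
  have hl2 : 0 ≤ R * Real.log 2 := mul_nonneg hR (Real.log_nonneg one_le_two)
  have between : ∀ a b : ℝ, a + b < 0 → ∃ κ, b < κ ∧ a < -κ := fun a b h =>
    ⟨(b - a) / 2, by linarith, by linarith⟩
  have relay : ∃ lamG lamH θG θH : ℝ, 0 ≤ lamG ∧ lamG ≤ 1 ∧ 0 ≤ lamH ∧ lamH ≤ 1 ∧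
      0 ≤ θG ∧ θG < 1 ∧ 0 ≤ θH ∧ θH < 1 ∧ ∀ n : ℕ, ∃ L : ℕ, 0 < L ∧
      ∑ z : Fin n → T × ΩRCrel S Q X1 X2 Y2 Y3 H, (∏ i, w (z i)) *
        mismatch lamG (∏ i, pQ (vS (z i).2) (vQ2 (z i).2))
          ((∏ i, rG ((z i).1, vY3 (z i).2) (vQ2 (z i).2)) / L) ≤ 2 * θG ^ n ∧
      ∑ z : Fin n → T × ΩRCrel S Q X1 X2 Y2 Y3 H, (∏ i, w (z i)) *
        mismatch lamH ((∏ i, pH (vY2 (z i).2, vQ2 (z i).2, vS (z i).2) (vYH (z i).2)) / L)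
          (∏ i, rH ((z i).1, vQ2 (z i).2, vY3 (z i).2) (vYH (z i).2)) ≤ 2 * θH ^ n := by
    rcases hrelay with ⟨h1, h2⟩ | hlt
    · refine ⟨0, 0, 0, 0, le_rfl, zero_le_one, le_rfl, zero_le_one, le_rfl, one_pos, le_rfl,
        one_pos, fun n => ⟨1, one_pos, ?_⟩⟩
      simp [h1, h2, mismatch]
    · obtain ⟨κ, hκ1, hκ2⟩ := between _ _ hlt
      obtain ⟨lamH, θH, a1, a2, a3, a4, a5⟩ := exists_binning_exponent hw
        (p := fun z => pH (vY2 z.2, vQ2 z.2, vS z.2) (vYH z.2))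
        (r := fun z => rH (z.1, vQ2 z.2, vY3 z.2) (vYH z.2))
        (fun z => (hpH _).1 _) posH hH (by exact hκ1)
      obtain ⟨lamG, θG, b1, b2, b3, b4, b5⟩ := exists_indexed_exponent hw
        (p := fun z => pQ (vS z.2) (vQ2 z.2))
        (r := fun z => rG (z.1, vY3 z.2) (vQ2 z.2)) (fun z => (hpQ _).1 _) posQ hG hκ2
      refine ⟨lamG, lamH, θG, θH, b1, b2, a1, a2, b3, b4, a3, a4, fun n => ?_⟩
      obtain ⟨L, hL, hL1, hL2⟩ := exists_nat_exp_le
        (mul_nonneg (Nat.cast_nonneg n) (hgibbs.trans hκ1.le))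
      exact ⟨L, hL, b5 n L hL hL2, a5 n L hL hL1⟩
  obtain ⟨lamG, lamH, θG, θH, g0, g1, k0, k1, g2, g3, k2, k3, hrel⟩ := relay
  obtain ⟨κ, hκ1, hκ2⟩ := exists_between (lt_neg.1 hsource)
  obtain ⟨lamX, θX, x0, x1, x2, x3, hsrc⟩ := exists_indexed_exponent hw
    (p := fun z => pX1 z.1 (vX1 z.2))
    (r := fun z => rX (z.1, vQ2 z.2, vYH z.2, vY3 z.2) (vX1 z.2)) (fun z => (hpX1 _).1 _)
    posX hX (lt_neg.1 hκ2)
  obtain ⟨B, hB⟩ := exists_nat_ge (R * Real.log 2 / (κ - R * Real.log 2))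
  rw [div_le_iff₀ (by linarith)] at hB
  intro ε hε
  have hlim : Filter.Tendsto (fun n : ℕ => ((B : ℝ) + 1) * (2 * θG ^ n + 2 * θH ^ n + 2 * θX ^ n))
      Filter.atTop (nhds (((B : ℝ) + 1) * (2 * 0 + 2 * 0 + 2 * 0))) :=
    ((((tendsto_pow_atTop_nhds_zero_of_lt_one g2 g3).const_mul 2).add
      ((tendsto_pow_atTop_nhds_zero_of_lt_one k2 k3).const_mul 2)).add
      ((tendsto_pow_atTop_nhds_zero_of_lt_one x2 x3).const_mul 2)).const_mul _
  obtain ⟨n, hn, hn0⟩ := ((hlim.eventually (gt_mem_nhds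
    (show ((B : ℝ) + 1) * (2 * 0 + 2 * 0 + 2 * 0) < ε by simpa using hε))).and
    (Filter.eventually_gt_atTop 0)).exists
  obtain ⟨L, hL, hεG, hεH⟩ := hrel n
  obtain ⟨M, hM, hM1, hM2⟩ := exists_nat_exp_le
    (mul_nonneg (Nat.cast_nonneg n) (hl2.trans hκ1.le))
  obtain ⟨enc1, enc2, dec2, hc, he⟩ := exists_compressForward_memoryless pT hpT pS hpS pQ hpQ
    pX2 hpX2 pX1 hpX1 W hW pH hpH rG hrG rH hrH rX hrX hL hM g0 g1 k0 k1 x0 x1 B n hεG hεH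
    (hsrc n M hM hM2)
  refine ⟨(B + 1) * n, M ^ B, enc1, enc2, dec2, by positivity, ?_, hc, he.trans hn.le⟩
  rw [Real.rpow_def_of_pos two_pos]
  push_cast
  calc Real.exp (Real.log 2 * ((B + 1) * n * R)) ≤ Real.exp (B * (n * κ)) := by
        refine Real.exp_le_exp.2 ?_
        have := mul_le_mul_of_nonneg_left hB (Nat.cast_nonneg (α := ℝ) n)
        linarith
    _ = Real.exp (n * κ) ^ B := Real.exp_nat_mul _ _
    _ ≤ (M : ℝ) ^ B := pow_le_pow_left₀ (Real.exp_pos _).le hM1 B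

section Distributions

variable {Ω A B : Type} [Fintype Ω]

lemma rvDist_pos {μ : Ω → ℝ} (hμ : IsPmf μ) (X : Ω → A) {ω : Ω} (h : μ ω ≠ 0) :
    0 < rvDist μ X (X ω) := by
  have hω : 0 < μ ω := lt_of_le_of_ne (hμ.1 ω) h.symm
  refine lt_of_lt_of_le hω ?_
  have := Finset.single_le_sum (f := fun ω' => if X ω' = X ω then μ ω' else 0)
    (fun ω' _ => by split_ifs <;> [exact hμ.1 _; exact le_rfl]) (Finset.mem_univ ω)
  simpa [rvDist] using this

lemma sum_rvDist_mul [Fintype A] (μ : Ω → ℝ) (X : Ω → A) (f : A → ℝ) :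
    ∑ a, rvDist μ X a * f a = ∑ ω, μ ω * f (X ω) := by
  simp only [rvDist, Finset.sum_mul, ite_mul, zero_mul]
  rw [Finset.sum_comm]
  simp

lemma isPmf_rvDist [Fintype A] {μ : Ω → ℝ} (hμ : IsPmf μ) (X : Ω → A) : IsPmf (rvDist μ X) := by
  refine ⟨fun a => Finset.sum_nonneg fun ω _ => ?_, ?_⟩
  · split_ifs <;> [exact hμ.1 _; exact le_rfl]
  · simpa [hμ.2] using sum_rvDist_mul μ X fun _ => 1

lemma sum_rvDist_prodMk [Fintype A] (μ : Ω → ℝ) (X : Ω → A) (Y : Ω → B) (b : B) :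
    ∑ a, rvDist μ (fun ω => (X ω, Y ω)) (a, b) = rvDist μ Y b := by
  simp only [rvDist, Prod.mk.injEq, ite_and]
  rw [Finset.sum_comm]
  simp

/-- The expected log-likelihood `𝔼 [log P_X(X)]`, that is, minus the entropy in nats. -/
def expLogDist (μ : Ω → ℝ) (X : Ω → A) : ℝ :=
  ∑ ω, μ ω * Real.log (rvDist μ X (X ω))

lemma rvEnt_mul_log_two [Fintype A] (μ : Ω → ℝ) (X : Ω → A) :
    rvEnt μ X * Real.log 2 = -expLogDist μ X := by
  have hl : Real.log 2 ≠ 0 := (Real.log_pos one_lt_two).ne'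
  rw [rvEnt, sum_rvDist_mul μ X fun a => Real.logb 2 (rvDist μ X a), neg_mul, Finset.sum_mul,
    expLogDist]
  congr 1
  refine Finset.sum_congr rfl fun ω _ => ?_
  rw [Real.logb, mul_assoc, div_mul_cancel₀ _ hl]

lemma expLogDist_comp (μ : Ω → ℝ) (X : Ω → A) {f : A → B} (hf : Function.Injective f) :
    expLogDist μ (fun ω => f (X ω)) = expLogDist μ X := by
  simp only [expLogDist, rvDist, hf.eq_iff]

/-- The conditional law of `X` given `Y`, set to the law of `X` off the support of `Y`. -/
def condKernel (μ : Ω → ℝ) (X : Ω → A) (Y : Ω → B) (b : B) (a : A) : ℝ :=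
  if rvDist μ Y b = 0 then rvDist μ X a
  else rvDist μ (fun ω => (X ω, Y ω)) (a, b) / rvDist μ Y b

lemma isKernel_condKernel [Fintype A] [Fintype B] {μ : Ω → ℝ} (hμ : IsPmf μ)
    (X : Ω → A) (Y : Ω → B) : IsKernel (condKernel μ X Y) := by
  intro b
  by_cases h : rvDist μ Y b = 0
  · simpa [condKernel, h, IsPmf] using isPmf_rvDist hμ X
  · refine ⟨fun a => ?_, ?_⟩
    · simp only [condKernel, h, if_false]
      exact div_nonneg ((isPmf_rvDist hμ _).1 _) ((isPmf_rvDist hμ _).1 _)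
    · simp only [condKernel, h, if_false]
      rw [← Finset.sum_div, sum_rvDist_prodMk, div_self h]

lemma condKernel_apply {μ : Ω → ℝ} (hμ : IsPmf μ) (X : Ω → A) (Y : Ω → B) {ω : Ω}
    (h : μ ω ≠ 0) : condKernel μ X Y (Y ω) (X ω) =
      rvDist μ (fun ω => (X ω, Y ω)) (X ω, Y ω) / rvDist μ Y (Y ω) :=
  if_neg (rvDist_pos hμ Y h).ne'

lemma condKernel_pos {μ : Ω → ℝ} (hμ : IsPmf μ) (X : Ω → A) (Y : Ω → B) {ω : Ω}
    (h : μ ω ≠ 0) : 0 < condKernel μ X Y (Y ω) (X ω) := by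
  rw [condKernel_apply hμ X Y h]
  exact div_pos (rvDist_pos hμ (fun ω => (X ω, Y ω)) h) (rvDist_pos hμ Y h)

lemma sum_mul_log_div_condKernel {μ c : Ω → ℝ} (hμ : IsPmf μ) (hc : ∀ ω, μ ω ≠ 0 → 0 < c ω)
    (X : Ω → A) (Y : Ω → B) :
    ∑ ω, μ ω * Real.log (c ω / condKernel μ X Y (Y ω) (X ω)) =
      ∑ ω, μ ω * Real.log (c ω) - expLogDist μ (fun ω => (X ω, Y ω)) + expLogDist μ Y := by
  simp only [expLogDist, ← Finset.sum_sub_distrib, ← Finset.sum_add_distrib]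
  refine Finset.sum_congr rfl fun ω _ => ?_
  by_cases h : μ ω = 0
  · simp [h]
  · rw [Real.log_div (hc ω h).ne' (condKernel_pos hμ X Y h).ne', condKernel_apply hμ X Y h,
      Real.log_div (rvDist_pos hμ (fun ω => (X ω, Y ω)) h).ne' (rvDist_pos hμ Y h).ne']
    ring

lemma sum_mul_log_of_rvDist_eq_mul {μ c : Ω → ℝ} (hμ : IsPmf μ) (X : Ω → A) (Y : Ω → B)
    (hc : ∀ ω, rvDist μ X (X ω) = c ω * rvDist μ Y (Y ω)) :
    ∑ ω, μ ω * Real.log (c ω) = expLogDist μ X - expLogDist μ Y := by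
  simp only [expLogDist, ← Finset.sum_sub_distrib]
  refine Finset.sum_congr rfl fun ω _ => ?_
  by_cases h : μ ω = 0
  · simp [h]
  · have h1 := rvDist_pos hμ X h
    have h2 := rvDist_pos hμ Y h
    rw [hc ω] at h1 ⊢
    rw [Real.log_mul (left_ne_zero_of_mul h1.ne') h2.ne']
    ring

lemma rvDist_eq_sum_mul (μ : Ω → ℝ) (X : Ω → A) (a : A) :
    rvDist μ X a = ∑ ω, μ ω * if X ω = a then 1 else 0 := by
  simp [rvDist]

lemma rvDist_prodMk_eq_sum_mul (μ : Ω → ℝ) (X : Ω → A) (Y : Ω → B) (a : A) (b : B) :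
    rvDist μ (fun ω => (X ω, Y ω)) (a, b) =
      ∑ ω, μ ω * if X ω = a then if Y ω = b then 1 else 0 else 0 := by
  simp [rvDist, ite_and]

end Distributions

section RelayMarginals

variable {S Q X1 X2 Y2 Y3 H : Type} [Fintype S]
  [Fintype Q] [Fintype X1] [Fintype X2] [Fintype Y2] [Fintype Y3] [Fintype H]
  {pS : S → ℝ} {pQ : S → Q → ℝ} {pX2 : Q × S → X2 → ℝ} {pX1 : X1 → ℝ}
  {W : X1 → X2 → S → Y2 × Y3 → ℝ} {pH : Y2 × Q × S → H → ℝ}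

lemma sum_relayPmf_mul (hpX2 : IsKernel pX2) (hW : ∀ x1 x2 s, IsPmf (W x1 x2 s))
    (hpH : IsKernel pH) (f : S → Q → X1 → ℝ) :
    ∑ ω, relayPmf pS pQ pX2 pX1 W pH ω * f (vS ω) (vQ2 ω) (vX1 ω) =
      ∑ s, ∑ q, ∑ x, pS s * pQ s q * pX1 x * f s q x := by
  have e : ∀ ω, relayPmf pS pQ pX2 pX1 W pH ω * f (vS ω) (vQ2 ω) (vX1 ω) =
      pS (vS ω) * pQ (vS ω) (vQ2 ω) * pX1 (vX1 ω) * f (vS ω) (vQ2 ω) (vX1 ω) *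
        (pX2 (vQ2 ω, vS ω) (vX2 ω) * (W (vX1 ω) (vX2 ω) (vS ω) (vY2 ω, vY3 ω) *
          pH (vY2 ω, vQ2 ω, vS ω) (vYH ω))) := fun ω => by
    simp only [relayPmf]; ring
  have hW' : ∀ x1 x2 s, ∑ y2, ∑ y3, W x1 x2 s (y2, y3) = 1 := fun x1 x2 s => by
    rw [← Fintype.sum_prod_type', (hW x1 x2 s).2]
  rw [Finset.sum_congr rfl fun ω _ => e ω]
  simp only [Fintype.sum_prod_type, vS, vQ2, vX1, vX2, vY2, vY3, vYH, ← Finset.mul_sum,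
    (hpH _).2, mul_one, hW', (hpX2 _).2]

lemma isPmf_relayPmf (hpS : IsPmf pS) (hpQ : IsKernel pQ) (hpX2 : IsKernel pX2)
    (hpX1 : IsPmf pX1) (hW : ∀ x1 x2 s, IsPmf (W x1 x2 s)) (hpH : IsKernel pH) :
    IsPmf (relayPmf pS pQ pX2 pX1 W pH) := by
  refine ⟨fun z => mul_nonneg (mul_nonneg (mul_nonneg (mul_nonneg (mul_nonneg (hpS.1 _)
    ((hpQ _).1 _)) ((hpX2 _).1 _)) (hpX1.1 _)) ((hW _ _ _).1 _)) ((hpH _).1 _), ?_⟩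
  have := sum_relayPmf_mul (pS := pS) (pQ := pQ) (pX1 := pX1) hpX2 hW hpH fun _ _ _ => 1
  simpa [← Finset.mul_sum, hpX1.2, (hpQ _).2, hpS.2] using this

lemma rvDist_relayPmf_vS (hpQ : IsKernel pQ) (hpX2 : IsKernel pX2)
    (hpX1 : IsPmf pX1) (hW : ∀ x1 x2 s, IsPmf (W x1 x2 s)) (hpH : IsKernel pH) (s : S) :
    rvDist (relayPmf pS pQ pX2 pX1 W pH) vS s = pS s := by
  rw [rvDist_eq_sum_mul, sum_relayPmf_mul hpX2 hW hpH fun s' _ _ => if s' = s then 1 else 0]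
  simp [← Finset.mul_sum, hpX1.2, (hpQ _).2]

lemma rvDist_relayPmf_vQ2_vS (hpX2 : IsKernel pX2)
    (hpX1 : IsPmf pX1) (hW : ∀ x1 x2 s, IsPmf (W x1 x2 s)) (hpH : IsKernel pH) (q : Q) (s : S) :
    rvDist (relayPmf pS pQ pX2 pX1 W pH) (fun ω => (vQ2 ω, vS ω)) (q, s) = pQ s q * pS s := by
  rw [rvDist_prodMk_eq_sum_mul,
    sum_relayPmf_mul hpX2 hW hpH fun s' q' _ => if q' = q then if s' = s then 1 else 0 else 0]
  simp [← Finset.sum_mul, hpX1.2, mul_comm]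

lemma rvDist_relayPmf_vX1 (hpS : IsPmf pS) (hpQ : IsKernel pQ) (hpX2 : IsKernel pX2)
    (hW : ∀ x1 x2 s, IsPmf (W x1 x2 s)) (hpH : IsKernel pH) (x : X1) :
    rvDist (relayPmf pS pQ pX2 pX1 W pH) vX1 x = pX1 x := by
  rw [rvDist_eq_sum_mul, sum_relayPmf_mul hpX2 hW hpH fun _ _ x' => if x' = x then 1 else 0]
  simp [← Finset.mul_sum, ← Finset.sum_mul, (hpQ _).2, hpS.2]

lemma rvDist_relayPmf_vX1_vQ2 (hpX2 : IsKernel pX2)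
    (hpX1 : IsPmf pX1) (hW : ∀ x1 x2 s, IsPmf (W x1 x2 s)) (hpH : IsKernel pH) (x : X1) (q : Q) :
    rvDist (relayPmf pS pQ pX2 pX1 W pH) (fun ω => (vX1 ω, vQ2 ω)) (x, q) =
      pX1 x * rvDist (relayPmf pS pQ pX2 pX1 W pH) vQ2 q := by
  rw [rvDist_prodMk_eq_sum_mul, rvDist_eq_sum_mul,
    sum_relayPmf_mul hpX2 hW hpH fun _ q' x' => if x' = x then if q' = q then 1 else 0 else 0,
    sum_relayPmf_mul hpX2 hW hpH fun _ q' _ => if q' = q then 1 else 0]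
  simp [← Finset.mul_sum, ← Finset.sum_mul, hpX1.2, mul_comm]

lemma rvDist_relayPmf_vYH (hpH : IsKernel pH) (h : H) (y2 : Y2) (s : S) (q : Q) (y3 : Y3) :
    rvDist (relayPmf pS pQ pX2 pX1 W pH)
        (fun ω => (vYH ω, (vY2 ω, vS ω), (vQ2 ω, vY3 ω))) (h, (y2, s), (q, y3)) =
      pH (y2, q, s) h * rvDist (relayPmf pS pQ pX2 pX1 W pH)
        (fun ω => ((vY2 ω, vS ω), (vQ2 ω, vY3 ω))) ((y2, s), (q, y3)) := by
  simp only [rvDist, relayPmf, Fintype.sum_prod_type, vS, vQ2, vX1, vX2, vY2, vY3, vYH,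
    Prod.mk.injEq, ite_and]
  simp [← Finset.mul_sum, (hpH _).2, ← Finset.sum_mul, mul_comm]

end RelayMarginals

section SingleLetter

variable {S Q X1 X2 Y2 Y3 H : Type}

/-- The time-sharing law revealing the channel input of the source with probability `δ`. -/
def revealPmf (δ : ℝ) (pX1 : X1 → ℝ) (t : Option X1) : ℝ :=
  t.elim (1 - δ) fun x => δ * pX1 x

/-- The input law given the time-sharing variable: deterministic when it is revealed. -/
def revealedInput (pX1 : X1 → ℝ) (t : Option X1) (x1 : X1) : ℝ :=
  t.elim (pX1 x1) fun x => if x1 = x then 1 else 0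

lemma timeSharedPmf_none (δ : ℝ) (pS : S → ℝ) (pQ : S → Q → ℝ) (pX2 : Q × S → X2 → ℝ)
    (pX1 : X1 → ℝ) (W : X1 → X2 → S → Y2 × Y3 → ℝ) (pH : Y2 × Q × S → H → ℝ)
    (ω : ΩRCrel S Q X1 X2 Y2 Y3 H) :
    timeSharedPmf (revealPmf δ pX1) pS pQ pX2 (revealedInput pX1) W pH (none, ω) =
      (1 - δ) * relayPmf pS pQ pX2 pX1 W pH ω := rfl

lemma timeSharedPmf_some (δ : ℝ) (pS : S → ℝ) (pQ : S → Q → ℝ) (pX2 : Q × S → X2 → ℝ)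
    (pX1 : X1 → ℝ) (W : X1 → X2 → S → Y2 × Y3 → ℝ) (pH : Y2 × Q × S → H → ℝ)
    (x : X1) (ω : ΩRCrel S Q X1 X2 Y2 Y3 H) :
    timeSharedPmf (revealPmf δ pX1) pS pQ pX2 (revealedInput pX1) W pH (some x, ω) =
      if vX1 ω = x then δ * relayPmf pS pQ pX2 pX1 W pH ω else 0 := by
  split_ifs with h
  · simp only [timeSharedPmf, revealPmf, revealedInput, relayPmf, Option.elim, h, if_true]
    ring
  · simp [timeSharedPmf, revealedInput, relayPmf, h]

variable [Fintype S] [Fintype Q] [Fintype X1] [Fintype X2] [Fintype Y2] [Fintype Y3] [Fintype H]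

lemma isPmf_revealPmf {δ : ℝ} (h0 : 0 ≤ δ) (h1 : δ ≤ 1) {pX1 : X1 → ℝ} (hpX1 : IsPmf pX1) :
    IsPmf (revealPmf δ pX1) := by
  refine ⟨fun t => ?_, ?_⟩
  · cases t with
    | none => exact sub_nonneg.2 h1
    | some x => exact mul_nonneg h0 (hpX1.1 x)
  · simp [Fintype.sum_option, revealPmf, ← Finset.mul_sum, hpX1.2]

lemma isKernel_revealedInput {pX1 : X1 → ℝ} (hpX1 : IsPmf pX1) :
    IsKernel (revealedInput pX1) := by
  intro t
  cases t with
  | none => exact hpX1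
  | some x =>
    refine ⟨fun y => ?_, by simp [revealedInput]⟩
    simp only [revealedInput, Option.elim]
    split_ifs <;> norm_num

lemma sum_timeSharedPmf_reveal_mul (δ : ℝ) (pS : S → ℝ) (pQ : S → Q → ℝ)
    (pX2 : Q × S → X2 → ℝ) (pX1 : X1 → ℝ) (W : X1 → X2 → S → Y2 × Y3 → ℝ)
    (pH : Y2 × Q × S → H → ℝ) (F : Option X1 × ΩRCrel S Q X1 X2 Y2 Y3 H → ℝ) :
    ∑ z, timeSharedPmf (revealPmf δ pX1) pS pQ pX2 (revealedInput pX1) W pH z * F z =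
      (1 - δ) * ∑ ω, relayPmf pS pQ pX2 pX1 W pH ω * F (none, ω) +
        δ * ∑ ω, relayPmf pS pQ pX2 pX1 W pH ω * F (some (vX1 ω), ω) := by
  rw [Fintype.sum_prod_type, Fintype.sum_option, Finset.sum_comm (s := univ (α := X1))]
  simp only [timeSharedPmf_none, timeSharedPmf_some, ite_mul, zero_mul, Finset.sum_ite_eq,
    Finset.mem_univ, if_true, Finset.mul_sum, mul_assoc]

lemma isPmf_sum_mul {A B : Type} [Fintype A] [Fintype B] {p : A → ℝ} (hp : IsPmf p)
    {k : A → B → ℝ} (hk : IsKernel k) : IsPmf fun b => ∑ a, p a * k a b := by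
  refine ⟨fun b => Finset.sum_nonneg fun a _ => mul_nonneg (hp.1 a) ((hk a).1 b), ?_⟩
  rw [Finset.sum_comm]
  simp [← Finset.mul_sum, (hk _).2, hp.2]

/-- Every rate below `I(X₁;Y₃)` is achieved without any cooperation of the relay. -/
theorem achievable_of_lt_rvMI
    (pS : S → ℝ) (hpS : IsPmf pS) (pQ : S → Q → ℝ) (hpQ : IsKernel pQ)
    (pX2 : Q × S → X2 → ℝ) (hpX2 : IsKernel pX2) (pX1 : X1 → ℝ) (hpX1 : IsPmf pX1)
    (W : X1 → X2 → S → Y2 × Y3 → ℝ) (hW : ∀ x1 x2 s, IsPmf (W x1 x2 s))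
    (pH : Y2 × Q × S → H → ℝ) (hpH : IsKernel pH) {R : ℝ} (hR : 0 ≤ R)
    (h : R < rvMI (relayPmf pS pQ pX2 pX1 W pH) vX1 vY3) : AchievableRCrel pS W R := by
  have hμ := isPmf_relayPmf hpS hpQ hpX2 hpX1 hW hpH
  have hX1 := rvDist_relayPmf_vX1 (pX1 := pX1) hpS hpQ hpX2 hW hpH
  set μ := relayPmf pS pQ pX2 pX1 W pH with hμdef
  have hone : IsPmf fun _ : Unit => (1 : ℝ) := ⟨fun _ => zero_le_one, by simp⟩
  set w := timeSharedPmf (fun _ : Unit => (1 : ℝ)) pS (fun _ (_ : Unit) => 1)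
    (fun a : Unit × S => fun x2 => ∑ q, pQ a.2 q * pX2 (q, a.2) x2) (fun _ => pX1) W
    (fun _ (_ : Unit) => 1) with hwdef
  have hw : ∀ z, w z = ∑ p : Q × H,
      μ (vS z.2, p.1, vX1 z.2, vX2 z.2, vY2 z.2, vY3 z.2, p.2) := fun z => by
    simp only [Fintype.sum_prod_type, hμdef, relayPmf, vS, vX1, vX2, vY2, vY3, vQ2, vYH,
      ← Finset.mul_sum, (hpH _).2, ← Finset.sum_mul, hwdef, timeSharedPmf]
    simp only [mul_assoc, ← Finset.mul_sum, one_mul, mul_one]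
  let e : (Unit × ΩRCrel S Unit X1 X2 Y2 Y3 Unit) × (Q × H) ≃ ΩRCrel S Q X1 X2 Y2 Y3 H :=
    { toFun := fun a => (vS a.1.2, a.2.1, vX1 a.1.2, vX2 a.1.2, vY2 a.1.2, vY3 a.1.2, a.2.2)
      invFun := fun ω => (((), (vS ω, (), vX1 ω, vX2 ω, vY2 ω, vY3 ω, ())), (vQ2 ω, vYH ω))
      left_inv := fun _ => rfl
      right_inv := fun _ => rfl }
  have hsum : ∀ f : X1 → Y3 → ℝ,
      ∑ z, w z * f (vX1 z.2) (vY3 z.2) = ∑ ω, μ ω * f (vX1 ω) (vY3 ω) := fun f => by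
    simp only [hw, Finset.sum_mul]
    exact (Fintype.sum_prod_type' _).symm.trans
      (e.sum_comp fun ω => μ ω * f (vX1 ω) (vY3 ω))
  refine achievable_of_logRatio (fun _ : Unit => (1 : ℝ)) hone pS hpS (fun _ (_ : Unit) => 1)
    (fun _ => hone) (fun a : Unit × S => fun x2 => ∑ q, pQ a.2 q * pX2 (q, a.2) x2)
    (fun a => isPmf_sum_mul (hpQ a.2) fun q => hpX2 (q, a.2)) (fun _ => pX1) (fun _ => hpX1) W hW
    (fun _ (_ : Unit) => 1) (fun _ => hone) (fun _ (_ : Unit) => 1) (fun _ => hone)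
    (fun _ (_ : Unit) => 1) (fun _ => hone) (fun a => condKernel μ vX1 vY3 a.2.2.2)
    (fun a => isKernel_condKernel hμ _ _ _) (fun _ _ => one_pos) (fun _ _ => one_pos) ?_
    (Or.inl ⟨fun _ _ => rfl, fun _ _ => rfl⟩) hR ?_
  · intro z hz
    obtain ⟨p, -, hp⟩ := Finset.exists_ne_zero_of_sum_ne_zero ((hw z).symm.trans_ne hz)
    exact condKernel_pos hμ vX1 vY3 hp
  · have h2 := mul_lt_mul_of_pos_right h (Real.log_pos one_lt_two)
    simp only [rvMI, sub_mul, add_mul, rvEnt_mul_log_two] at h2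
    refine (hsum fun x y => Real.log (pX1 x / condKernel μ vX1 vY3 y x)).trans_lt ?_
    simp only [← hX1] at h2 ⊢
    rw [sum_mul_log_div_condKernel (c := fun ω => rvDist μ vX1 (vX1 ω)) hμ
      (fun ω hω => rvDist_pos hμ vX1 hω)]
    change expLogDist μ vX1 - _ + _ < _
    linarith

end SingleLetter

/-- **SD-RC with non-causal perfect CSI only at the relay.**  If random variables
`Q₂, X₂, Ŷ₂` together with `(S, X₁, Y₂, Y₃)` have a joint pmf factoring as
`p(s) p(q₂|s) p(x₂|q₂,s) p(x₁) p(y₂,y₃|x₁,x₂,s) p(ŷ₂|y₂,q₂,s)`, and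
`R13 < I(X₁;Ŷ₂,Y₃|Q₂)` subject to
`I(Ŷ₂;Y₂,S|Q₂,Y₃) ≤ I(Q₂;Y₃) − I(Q₂;S)`, then the rate `R13` is achievable. -/
theorem sdrc_noncausal_relay_achievable
    {𝒳₁ 𝒳₂ 𝒴₂ 𝒴₃ 𝒮 Q₂ YH : Type}
    [Fintype 𝒳₁] [Fintype 𝒳₂] [Fintype 𝒴₂] [Fintype 𝒴₃] [Fintype 𝒮]
    [Fintype Q₂] [Fintype YH]
    (pS : 𝒮 → ℝ) (hpS : IsPmf pS)
    (W : 𝒳₁ → 𝒳₂ → 𝒮 → 𝒴₂ × 𝒴₃ → ℝ) (hW : ∀ x1 x2 s, IsPmf (W x1 x2 s))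
    (pQ : 𝒮 → Q₂ → ℝ) (hpQ : IsKernel pQ)
    (pX2 : Q₂ × 𝒮 → 𝒳₂ → ℝ) (hpX2 : IsKernel pX2)
    (pX1 : 𝒳₁ → ℝ) (hpX1 : IsPmf pX1)
    (pYH : 𝒴₂ × Q₂ × 𝒮 → YH → ℝ) (hpYH : IsKernel pYH)
    (μ : ΩRCrel 𝒮 Q₂ 𝒳₁ 𝒳₂ 𝒴₂ 𝒴₃ YH → ℝ)
    (hμ : ∀ s q2 x1 x2 y2 y3 yh,
      μ (s, q2, x1, x2, y2, y3, yh) =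
        pS s * pQ s q2 * pX2 (q2, s) x2 * pX1 x1 * W x1 x2 s (y2, y3) *
          pYH (y2, q2, s) yh)
    (R13 : ℝ) (hR13 : 0 ≤ R13)
    (h1 : R13 < rvCMI μ vX1 (fun ω => (vYH ω, vY3 ω)) vQ2)
    (h2 : rvCMI μ vYH (fun ω => (vY2 ω, vS ω)) (fun ω => (vQ2 ω, vY3 ω))
          ≤ rvMI μ vQ2 vY3 - rvMI μ vQ2 vS) :
    AchievableRCrel pS W R13 := by
  obtain rfl : μ = relayPmf pS pQ pX2 pX1 W pYH :=
    funext fun ω => hμ ω.1 ω.2.1 ω.2.2.1 ω.2.2.2.1 ω.2.2.2.2.1 ω.2.2.2.2.2.1 ω.2.2.2.2.2.2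
  clear hμ
  by_cases hdirect : R13 < rvMI (relayPmf pS pQ pX2 pX1 W pYH) vX1 vY3
  · exact achievable_of_lt_rvMI pS hpS pQ hpQ pX2 hpX2 pX1 hpX1 W hW pYH hpYH hR13 hdirect
  have hpmf := isPmf_relayPmf hpS hpQ hpX2 hpX1 hW hpYH
  have eS := rvDist_relayPmf_vS (pS := pS) hpQ hpX2 hpX1 hW hpYH
  have eQS := rvDist_relayPmf_vQ2_vS (pS := pS) (pQ := pQ) hpX2 hpX1 hW hpYH
  have eX := rvDist_relayPmf_vX1 (pX1 := pX1) hpS hpQ hpX2 hW hpYH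
  have eXQ := rvDist_relayPmf_vX1_vQ2 (pS := pS) (pQ := pQ) hpX2 hpX1 hW hpYH
  have eH := rvDist_relayPmf_vYH (pS := pS) (pQ := pQ) (pX2 := pX2) (pX1 := pX1) (W := W) hpYH
  have posQ : ∀ ω, relayPmf pS pQ pX2 pX1 W pYH ω ≠ 0 → 0 < pQ (vS ω) (vQ2 ω) :=
    fun ω hω => lt_of_le_of_ne ((hpQ _).1 _) fun h => hω (by simp [relayPmf, ← h])
  have posH : ∀ ω, relayPmf pS pQ pX2 pX1 W pYH ω ≠ 0 → 0 < pYH (vY2 ω, vQ2 ω, vS ω) (vYH ω) :=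
    fun ω hω => lt_of_le_of_ne ((hpYH _).1 _) fun h => hω (by simp [relayPmf, ← h])
  have posX : ∀ ω, relayPmf pS pQ pX2 pX1 W pYH ω ≠ 0 → 0 < pX1 (vX1 ω) :=
    fun ω hω => lt_of_le_of_ne (hpX1.1 _) fun h => hω (by simp [relayPmf, ← h])
  have support : ∀ δ t ω,
      timeSharedPmf (revealPmf δ pX1) pS pQ pX2 (revealedInput pX1) W pYH (t, ω) ≠ 0 →
        relayPmf pS pQ pX2 pX1 W pYH ω ≠ 0 ∧ ∀ x, t = some x → vX1 ω = x := by
    rintro δ (_ | x) ω h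
    · rw [timeSharedPmf_none] at h
      exact ⟨right_ne_zero_of_mul h, by simp⟩
    · rw [timeSharedPmf_some] at h
      by_cases hx : vX1 ω = x
      · rw [if_pos hx] at h
        exact ⟨right_ne_zero_of_mul h, by simp [hx]⟩
      · exact absurd (if_neg hx) h
  have hmix := fun δ => sum_timeSharedPmf_reveal_mul δ pS pQ pX2 pX1 W pYH
  have lQ := sum_mul_log_of_rvDist_eq_mul (c := fun ω => pQ (vS ω) (vQ2 ω)) hpmf
    (fun ω => (vQ2 ω, vS ω)) vS fun ω => by rw [eQS, eS]
  have lH := sum_mul_log_of_rvDist_eq_mul (c := fun ω => pYH (vY2 ω, vQ2 ω, vS ω) (vYH ω)) hpmf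
    (fun ω => (vYH ω, (vY2 ω, vS ω), (vQ2 ω, vY3 ω)))
    (fun ω => ((vY2 ω, vS ω), (vQ2 ω, vY3 ω))) fun ω => eH _ _ _ _ _
  have lXQ := sum_mul_log_of_rvDist_eq_mul (c := fun ω => pX1 (vX1 ω)) hpmf
    (fun ω => (vX1 ω, vQ2 ω)) vQ2 fun ω => eXQ _ _
  set μ := relayPmf pS pQ pX2 pX1 W pYH
  have lX : ∑ ω, μ ω * Real.log (pX1 (vX1 ω)) = expLogDist μ vX1 := by
    simp only [expLogDist, eX]
  have r1 := expLogDist_comp μ (fun ω => ((vYH ω, vY3 ω), vQ2 ω))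
    (f := fun a => (a.1.1, (a.2, a.1.2))) fun a b h => by
      simp only [Prod.mk.injEq] at h; ext <;> simp [h]
  have r2 := expLogDist_comp μ (fun ω => (vX1 ω, ((vYH ω, vY3 ω), vQ2 ω)))
    (f := fun a => (a.2.1.1, (a.2.2, (a.1, a.2.1.2)))) fun a b h => by
      simp only [Prod.mk.injEq] at h; ext <;> simp [h]
  have gN := sum_mul_log_div_condKernel hpmf posQ vQ2 vY3
  have gS := sum_mul_log_div_condKernel hpmf posQ vQ2 fun ω => (vX1 ω, vY3 ω)
  have hN := sum_mul_log_div_condKernel hpmf posH vYH fun ω => (vQ2 ω, vY3 ω)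
  have hS := sum_mul_log_div_condKernel hpmf posH vYH fun ω => (vQ2 ω, (vX1 ω, vY3 ω))
  have xN := sum_mul_log_div_condKernel hpmf posX vX1 fun ω => ((vYH ω, vY3 ω), vQ2 ω)
  set I := rvCMI μ vX1 (fun ω => (vYH ω, vY3 ω)) vQ2 with hI
  have hl2 : 0 < Real.log 2 := Real.log_pos one_lt_two
  have hI' := congrArg (· * Real.log 2) hI
  have h2' := mul_le_mul_of_nonneg_right h2 hl2.le
  have h3 := mul_lt_mul_of_pos_right ((not_lt.1 hdirect).trans_lt h1) hl2
  simp only [rvCMI, rvMI, sub_mul, add_mul, rvEnt_mul_log_two] at hI' h2' h3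
  have hIpos : 0 < I := hR13.trans_lt h1
  set δ := (I - R13) / (2 * I) with hδ
  have hδ0 : 0 < δ := div_pos (sub_pos.2 h1) (by linarith)
  have hδ1 : δ ≤ 1 := (div_le_one (by linarith)).2 (by linarith)
  have hδI : R13 < (1 - δ) * I := by
    have : δ * I = (I - R13) / 2 := by rw [hδ]; field_simp
    linarith
  have relay_lt_zero : ∀ a b c d : ℝ, a + c ≤ 0 → b + d < 0 →
      (1 - δ) * a + δ * b + ((1 - δ) * c + δ * d) < 0 := fun a b c d h h' => by
    have := mul_nonpos_of_nonneg_of_nonpos (sub_nonneg.2 hδ1) h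
    have := mul_neg_of_pos_of_neg hδ0 h'
    linarith
  refine achievable_of_logRatio (revealPmf δ pX1) (isPmf_revealPmf hδ0.le hδ1 hpX1) pS hpS pQ hpQ
    pX2 hpX2 (revealedInput pX1) (isKernel_revealedInput hpX1) W hW pYH hpYH
    (fun a => a.1.elim (condKernel μ vQ2 vY3 a.2)
      fun x => condKernel μ vQ2 (fun ω => (vX1 ω, vY3 ω)) (x, a.2)) ?_
    (fun a => a.1.elim (condKernel μ vYH (fun ω => (vQ2 ω, vY3 ω)) (a.2.1, a.2.2))
      fun x => condKernel μ vYH (fun ω => (vQ2 ω, (vX1 ω, vY3 ω))) (a.2.1, (x, a.2.2))) ?_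
    (fun a => a.1.elim (condKernel μ vX1 (fun ω => ((vYH ω, vY3 ω), vQ2 ω))
      ((a.2.2.1, a.2.2.2), a.2.1)) fun x => revealedInput pX1 (some x)) ?_ ?_ ?_ ?_
    (Or.inr ?_) hR13 ?_
  · rintro ⟨_ | x, a⟩ <;> exact isKernel_condKernel hpmf _ _ _
  · rintro ⟨_ | x, a⟩ <;> exact isKernel_condKernel hpmf _ _ _
  · rintro ⟨_ | x, a⟩
    · exact isKernel_condKernel hpmf _ _ _
    · exact isKernel_revealedInput hpX1 _
  · rintro ⟨_ | x, ω⟩ hz <;> obtain ⟨hω, hx⟩ := support _ _ _ hz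
    · exact condKernel_pos hpmf vQ2 vY3 hω
    · obtain rfl := hx x rfl
      exact condKernel_pos hpmf vQ2 (fun ω => (vX1 ω, vY3 ω)) hω
  · rintro ⟨_ | x, ω⟩ hz <;> obtain ⟨hω, hx⟩ := support _ _ _ hz
    · exact condKernel_pos hpmf vYH (fun ω => (vQ2 ω, vY3 ω)) hω
    · obtain rfl := hx x rfl
      exact condKernel_pos hpmf vYH (fun ω => (vQ2 ω, (vX1 ω, vY3 ω))) hω
  · rintro ⟨_ | x, ω⟩ hz <;> obtain ⟨hω, hx⟩ := support _ _ _ hz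
    · exact condKernel_pos hpmf vX1 (fun ω => ((vYH ω, vY3 ω), vQ2 ω)) hω
    · obtain rfl := hx x rfl
      simp [revealedInput]
  · rw [hmix, hmix]
    simp only [Option.elim]
    refine relay_lt_zero _ _ _ _ ?_ ?_
    · rw [gN, hN, lQ, lH]
      linarith
    · rw [gS, hS, lQ, lH]
      linarith
  · rw [hmix]
    simp only [Option.elim, revealedInput, if_true]
    have hsome : ∑ ω, μ ω * Real.log (1 / 1) = 0 := by simp
    have hnone : ∑ ω, μ ω * Real.log (pX1 (vX1 ω) /
        condKernel μ vX1 (fun ω => ((vYH ω, vY3 ω), vQ2 ω)) ((vYH ω, vY3 ω), vQ2 ω) (vX1 ω)) =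
        -(I * Real.log 2) := by
      rw [xN, lX]
      linarith
    rw [hsome, hnone]
    have := mul_lt_mul_of_pos_right hδI hl2
    linarith

end
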